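/- arXiv:2101.03145 — 2 statements merged into one kernel-verified Lean document; each statement's English description precedes it below -/
import Mathlib

section
/- Let F be a number field with odd class number, and let 𝔞 be a squarefree integral ideal of odd norm. If K/F and K'/F are two quadratic extensions, each ramified exactly at the prime ideals dividing 𝔞 (and unramified at all other finite primes, at all primes above 2, and at all infinite places), then K = K'. -/
open NumberField

/-- A prime ideal `𝔭` of `F` is ramified in `K` if some prime of `K` appears at least
twice in the factorization of `𝔭 O_K`. -/
def IsRamifiedIn (F K : Type*) [Field F] [NumberField F] [Field K] [NumberField K]
    [Algebra F K] (𝔭 : Ideal (𝓞 F)) : Prop :=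
  ∃ 𝔓 : Ideal (𝓞 K), 𝔓.IsPrime ∧ 𝔓 ^ 2 ∣ Ideal.map (algebraMap (𝓞 F) (𝓞 K)) 𝔭

/-- `K/F` is unramified at all infinite places: every real embedding of `F`
extends to a real embedding of `K`. -/
def UnramifiedAtInfinitePlaces (F K : Type*) [Field F] [Field K] [Algebra F K] : Prop :=
  ∀ φ : F →+* ℝ, ∃ ψ : K →+* ℝ, ψ.comp (algebraMap F K) = φ

theorem aux_quadEquiv {F K : Type*} [Field F] [Field K] [Algebra F K]
    (hdeg : Module.finrank F K = 2) (γ : F) (x : K) (hx : x ^ 2 = algebraMap F K γ)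
    (hnot : ∀ r : F, algebraMap F K r ≠ x) :
    ∃ e : QuadraticAlgebra F γ 0 ≃ₐ[F] K, ∀ z, e z = algebraMap F K z.re + algebraMap F K z.im * x := by
  have : FiniteDimensional F K := Module.finite_of_finrank_eq_succ hdeg
  let f : QuadraticAlgebra F γ 0 →ₐ[F] K := QuadraticAlgebra.lift ⟨x, by
    rw [← sq, hx]; simp [Algebra.algebraMap_eq_smul_one]⟩
  have hf : ∀ z, f z = algebraMap F K z.re + algebraMap F K z.im * x := by
    intro z
    simp [f, Algebra.smul_def]
  have hinj : Function.Injective f := by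
    rw [injective_iff_map_eq_zero]
    intro z hz
    rw [hf] at hz
    by_cases h : z.im = 0
    · simp [h] at hz
      ext <;> simp [h, hz]
    · exfalso
      apply hnot (-z.re / z.im)
      have : algebraMap F K z.im ≠ 0 := by simpa using h
      rw [map_div₀, map_neg]
      field_simp
      linear_combination -hz
  have hsurj : Function.Surjective f := by
    have := (LinearMap.injective_iff_surjective_of_finrank_eq_finrank (f := f.toLinearMap)
      (by rw [QuadraticAlgebra.finrank_eq_two, hdeg])).1 hinj
    exact this
  exact ⟨AlgEquiv.ofBijective f ⟨hinj, hsurj⟩, hf⟩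

theorem aux_exists_sqrt {F K : Type*} [Field F] [CharZero F] [Field K] [Algebra F K]
    (hdeg : Module.finrank F K = 2) :
    ∃ (γ : F) (x : K), x ^ 2 = algebraMap F K γ ∧ ∀ r : F, algebraMap F K r ≠ x := by
  have : FiniteDimensional F K := Module.finite_of_finrank_eq_succ hdeg
  have h1 : ∃ y : K, ∀ r : F, algebraMap F K r ≠ y := by
    by_contra! h
    have hs : Function.Surjective (Algebra.linearMap F K) := h
    have := LinearMap.finrank_le_finrank_of_injective (f := (LinearEquiv.ofBijective _ 
      ⟨(algebraMap F K).injective, hs⟩).symm.toLinearMap) (LinearEquiv.injective _)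
    simp [hdeg] at this
  obtain ⟨y, hy⟩ := h1
  have h2 : ∃ a b : F, y ^ 2 = algebraMap F K a * y + algebraMap F K b := by
    have hd : ¬ LinearIndependent F ![1, y, y ^ 2] := by
      intro h
      have := h.fintype_card_le_finrank
      simp [hdeg] at this
    rw [Fintype.not_linearIndependent_iff] at hd
    obtain ⟨g, hg, i, hi⟩ := hd
    simp [Fin.sum_univ_three, Algebra.smul_def] at hg
    have h2 : g 2 ≠ 0 := by
      intro h2
      have h1 : g 1 ≠ 0 := by
        intro h1
        simp [h1, h2] at hg
        fin_cases i <;> simp_all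
      apply hy (- g 0 / g 1)
      have : algebraMap F K (g 1) ≠ 0 := by simpa using h1
      rw [map_div₀, map_neg]
      field_simp
      rw [h2, map_zero] at hg
      linear_combination -hg
    refine ⟨- g 1 / g 2, - g 0 / g 2, ?_⟩
    have : algebraMap F K (g 2) ≠ 0 := by simpa using h2
    rw [map_div₀, map_neg, map_div₀, map_neg]
    field_simp
    linear_combination hg
  obtain ⟨a, b, hab⟩ := h2
  have h2 : (2 : F) ≠ 0 := two_ne_zero
  refine ⟨a ^ 2 + 4 * b, 2 * y - algebraMap F K a, ?_, ?_⟩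
  · simp only [map_add, map_mul, map_pow, map_ofNat]
    linear_combination 4 * hab
  · intro r hr
    apply hy ((r + a) / 2)
    have : (2 : K) ≠ 0 := by
      have := (map_ne_zero (algebraMap F K)).2 h2
      rwa [map_ofNat] at this
    rw [map_div₀, map_add, hr]
    simp only [map_ofNat]
    field_simp
    ring

/-- quadratic setup -/
structure QSetup (F K : Type*) [Field F] [Field K] [Algebra F K] (γ : F) where
  x : K
  hx : x ^ 2 = algebraMap F K γ
  hnot : ∀ r : F, algebraMap F K r ≠ x
  σ : K ≃ₐ[F] K
  hσ : σ x = -x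
  dec : ∀ y : K, ∃ r s : F, y = algebraMap F K r + algebraMap F K s * x

theorem aux_setup {F K : Type*} [Field F] [Field K] [Algebra F K]
    (hdeg : Module.finrank F K = 2) (γ : F) (x : K) (hx : x ^ 2 = algebraMap F K γ)
    (hnot : ∀ r : F, algebraMap F K r ≠ x) :
    Nonempty (QSetup F K γ) := by
  obtain ⟨e, he⟩ := aux_quadEquiv hdeg γ x hx hnot
  obtain ⟨e', he'⟩ := aux_quadEquiv hdeg γ (-x) (by simpa using hx) (by
    intro r hr
    apply hnot (-r)
    simp [hr])
  refine ⟨⟨x, hx, hnot, e.symm.trans e', ?_, ?_⟩⟩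
  · have : e.symm x = ⟨0, 1⟩ := by
      rw [AlgEquiv.symm_apply_eq, he]; simp
    simp [this, he']
  · intro y
    exact ⟨(e.symm y).re, (e.symm y).im, by rw [← he]; simp⟩

section
variable {F K : Type*} [Field F] [Field K] [Algebra F K] {γ : F} (S : QSetup F K γ)
include S

theorem QSetup.invol (y : K) : S.σ (S.σ y) = y := by
  obtain ⟨r, s, rfl⟩ := S.dec y
  simp [S.hσ]

theorem QSetup.fixed [CharZero F] (y : K) (h : S.σ y = y) : ∃ r : F, algebraMap F K r = y := by
  obtain ⟨r, s, rfl⟩ := S.dec y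
  refine ⟨r, ?_⟩
  simp [S.hσ] at h
  have : CharZero K := charZero_of_injective_algebraMap (algebraMap F K).injective
  have h0 : algebraMap F K s * S.x = 0 := by
    rw [← mul_eq_zero_iff_left (two_ne_zero (α := K))]
    linear_combination -h
  rw [h0, add_zero]

theorem QSetup.x_ne : S.x ≠ 0 := by
  intro h
  exact S.hnot 0 (by simp [h])

theorem QSetup.g_ne : γ ≠ 0 := by
  intro h
  have h3 : S.x ^ 2 = 0 := S.hx.trans (by simp [h])
  exact S.x_ne (by simpa using h3)

theorem QSetup.eq_one_or [CharZero F] (g : K ≃ₐ[F] K) : g = 1 ∨ g = S.σ := by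
  have hg : (g S.x) ^ 2 = S.x ^ 2 := by rw [← map_pow, S.hx]; simp
  rcases sq_eq_sq_iff_eq_or_eq_neg.1 hg with h | h
  · left
    ext y
    obtain ⟨r, s, rfl⟩ := S.dec y
    simp [h]
  · right
    ext y
    obtain ⟨r, s, rfl⟩ := S.dec y
    simp [h, S.hσ]

theorem QSetup.ne_one [CharZero F] : S.σ ≠ 1 := by
  intro h
  obtain ⟨r, hr⟩ := S.fixed S.x (by simp [h])
  exact S.hnot r hr

end
theorem aux_rank_nullity {A B : Type*} [AddCommGroup A] [AddCommGroup B] [Module.Finite ℤ A]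
    (f : A →ₗ[ℤ] B) :
    Module.finrank ℤ f.range + Module.finrank ℤ f.ker = Module.finrank ℤ A := by
  rw [← Submodule.finrank_quotient_add_finrank f.ker, f.quotKerEquivRange.finrank_eq]

theorem aux_index_two' (A T : Type*) [AddCommGroup A] [Module.Finite ℤ A] [AddCommGroup T]
    [Finite T] (n : ℕ) (f : A ≃+ (Fin n →₀ ℤ) × T) :
    (AddMonoidHom.range (nsmulAddMonoidHom (α := A) 2)).index =
      2 ^ Module.finrank ℤ A * Nat.card (AddMonoidHom.ker (nsmulAddMonoidHom (α := A) 2)) := by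
  have : Module.Finite ℤ ((Fin n →₀ ℤ) × T) := Module.Finite.equiv f.toIntLinearEquiv
  have hrank : Module.finrank ℤ A = n := by
    rw [f.toIntLinearEquiv.finrank_eq]
    have h1 := aux_rank_nullity (LinearMap.fst ℤ (Fin n →₀ ℤ) T)
    rw [LinearMap.range_eq_top.2 LinearMap.fst_surjective, finrank_top] at h1
    have h2 : Module.finrank ℤ (LinearMap.fst ℤ (Fin n →₀ ℤ) T).ker = 0 := by
      refine Module.finrank_eq_zero_of_rank_eq_zero (rank_eq_zero_iff.2 ?_)
      rintro ⟨⟨v, t⟩, hv⟩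
      have hv : v = 0 := hv
      subst hv
      refine ⟨(Nat.card T : ℤ), by exact_mod_cast Nat.card_pos.ne', ?_⟩
      apply Subtype.ext
      refine Prod.ext (smul_zero _) ?_
      change (Nat.card T : ℤ) • t = 0
      rw [natCast_zsmul]
      exact card_nsmul_eq_zero'
    rw [h2] at h1
    simpa using h1.symm
  let D := nsmulAddMonoidHom (α := T) 2
  let Q := T ⧸ D.range
  let g1 : (Fin n →₀ ℤ) →+ (Fin n → ZMod 2) :=
    { toFun := fun v i => (v i : ZMod 2)
      map_zero' := by ext; simp
      map_add' := by intros; ext; simp }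
  let g : (Fin n →₀ ℤ) × T →+ (Fin n → ZMod 2) × Q := g1.prodMap (QuotientAddGroup.mk' D.range)
  let G : A →+ (Fin n → ZMod 2) × Q := g.comp f.toAddMonoidHom
  have hGs : Function.Surjective G := by
    refine Function.Surjective.comp (g := g) ?_ f.surjective
    change Function.Surjective (Prod.map g1 (QuotientAddGroup.mk' D.range))
    refine Function.Surjective.prodMap ?_ (QuotientAddGroup.mk'_surjective D.range)
    intro w
    refine ⟨Finsupp.equivFunOnFinite.symm fun i => ((w i).val : ℤ), ?_⟩
    ext i
    simp [g1]
  have hker : G.ker = AddMonoidHom.range (nsmulAddMonoidHom (α := A) 2) := by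
    ext a
    constructor
    · intro ha
      have ha : g (f a) = 0 := ha
      have h1 : g1 (f a).1 = 0 := congrArg Prod.fst ha
      have h2 : QuotientAddGroup.mk' D.range (f a).2 = 0 := congrArg Prod.snd ha
      rw [← AddMonoidHom.mem_ker, QuotientAddGroup.ker_mk'] at h2
      obtain ⟨t, ht⟩ := h2
      have h3 : ∀ i, ∃ k, (f a).1 i = 2 * k := by
        intro i
        have := congrFun h1 i
        exact (ZMod.intCast_zmod_eq_zero_iff_dvd _ 2).1 this
      choose k hk using h3
      refine ⟨f.symm (Finsupp.equivFunOnFinite.symm k, t), ?_⟩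
      apply f.injective
      have ht : (2 : ℕ) • t = (f a).2 := ht
      simp only [nsmulAddMonoidHom_apply, map_nsmul, AddEquiv.apply_symm_apply]
      refine Prod.ext ?_ ht
      ext i
      simp [hk]
    · rintro ⟨b, rfl⟩
      change g (f (2 • b)) = 0
      rw [map_nsmul, map_nsmul]
      refine Prod.ext ?_ ?_
      · ext i
        change (2 : ℕ) • ((f b).1 i : ZMod 2) = 0
        rw [nsmul_eq_mul]
        have : ((2 : ℕ) : ZMod 2) = 0 := by decide
        rw [this, zero_mul]
      · change (2 : ℕ) • QuotientAddGroup.mk' D.range (f b).2 = 0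
        rw [← map_nsmul, ← AddMonoidHom.mem_ker, QuotientAddGroup.ker_mk']
        exact ⟨_, rfl⟩
  have hQ : Nat.card Q = Nat.card D.ker := by
    have h1 := D.range.card_mul_index
    have h2 := D.ker.card_mul_index
    rw [AddSubgroup.index_ker] at h2
    have h3 : Nat.card D.range ≠ 0 := Nat.card_pos.ne'
    have : Nat.card Q = D.range.index := rfl
    rw [this]
    apply Nat.eq_of_mul_eq_mul_left (Nat.pos_of_ne_zero h3)
    rw [h1, ← h2, mul_comm]
  have hK : Nat.card (AddMonoidHom.ker (nsmulAddMonoidHom (α := A) 2)) = Nat.card D.ker := by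
    refine Nat.card_congr ⟨fun a => ⟨(f a.1).2, ?_⟩, fun t => ⟨f.symm (0, t.1), ?_⟩, ?_, ?_⟩
    · have : 2 • a.1 = 0 := a.2
      change 2 • (f a.1).2 = 0
      rw [← Prod.smul_snd, ← map_nsmul, this]
      simp
    · have : 2 • t.1 = 0 := t.2
      change 2 • f.symm (0, t.1) = 0
      rw [← map_nsmul]
      simp [this]
    · intro a
      have : 2 • a.1 = 0 := a.2
      have h2 : 2 • (f a.1).1 = 0 := by
        rw [← Prod.smul_fst, ← map_nsmul, this]; simp
      have h3 : (f a.1).1 = 0 := by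
        ext i
        have := DFunLike.congr_fun h2 i
        simpa using this
      apply Subtype.ext
      apply f.injective
      simp [← h3]
    · intro t
      simp
  rw [← hker, AddSubgroup.index_ker, AddMonoidHom.range_eq_top.2 hGs, hrank, hK, ← hQ]
  simp [Nat.card_prod]

theorem aux_index_two (A : Type*) [AddCommGroup A] [Module.Finite ℤ A] :
    (AddMonoidHom.range (nsmulAddMonoidHom (α := A) 2)).index =
      2 ^ Module.finrank ℤ A * Nat.card (AddMonoidHom.ker (nsmulAddMonoidHom (α := A) 2)) := by
  classical
  have : AddGroup.FG A := Module.Finite.iff_addGroup_fg.1 inferInstance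
  obtain ⟨n, ι, _, p, hp, e, ⟨f⟩⟩ := AddCommGroup.equiv_free_prod_directSum_zmod A
  have hne : ∀ i, NeZero (p i ^ e i) := fun i => ⟨pow_ne_zero _ (hp i).ne_zero⟩
  have hTfin : Finite (DirectSum ι fun i => ZMod (p i ^ e i)) := Finite.of_injective (fun t => fun i => t i) (by
    intro a b h
    exact DFunLike.ext _ _ fun i => congrFun h i)
  exact aux_index_two' A _ n f

/-- the counting -/
theorem aux_count {E e : Type*} [CommGroup E] [CommGroup e] (N : E →* e) (ι : e →* E) (σ : E →* E)
    (hN : ∀ u, ι (N u) = u * σ u) (hι : ∀ v, N (ι v) = v ^ 2) (hσι : ∀ v, σ (ι v) = ι v)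
    (hNσ : ∀ u, N (σ u) = N u)
    (hH : ∀ ε, N ε = 1 → ∃ u, u = ε * σ u) :
    (powMonoidHom (α := N.ker) 2).range.index ∣ (powMonoidHom (α := e) 2).range.index := by
  let φ : E →* N.ker := 
    { toFun := fun u => ⟨u / σ u, by rw [MonoidHom.mem_ker, map_div, hNσ, div_self']⟩
      map_one' := by ext; simp
      map_mul' := by intro a b; ext; simp [mul_div_mul_comm] }
  have hφ : Function.Surjective φ := by
    rintro ⟨ε, hε⟩
    obtain ⟨u, hu⟩ := hH ε hε
    exact ⟨u, Subtype.ext (div_eq_of_eq_mul'' hu)⟩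
  rw [← Subgroup.index_comap_of_surjective _ hφ]
  refine (Subgroup.index_dvd_of_le (H := (powMonoidHom (α := e) 2).range.comap N) ?_).trans ?_
  · rintro u ⟨v, hv⟩
    have hv : v ^ 2 = N u := hv
    have hw : N (u / ι v) = 1 := by rw [map_div, hι, hv, div_self']
    refine ⟨⟨u / ι v, hw⟩, ?_⟩
    apply Subtype.ext
    change (u / ι v) ^ 2 = u / σ u
    have h2 : (u / ι v) * σ (u / ι v) = 1 := by rw [← hN, hw, map_one]
    have h3 : σ u = ι v * (u / ι v)⁻¹ := by
      rw [eq_mul_inv_iff_mul_eq, ← hσι v, mul_comm, ← hσι v] 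
      rw [map_div, hσι] at h2
      rw [hσι, hσι]
      rw [mul_div_assoc', div_eq_one] at h2
      exact h2
    rw [h3]
    simp [sq, div_eq_mul_inv, mul_comm, mul_left_comm]
  · rw [Subgroup.index_comap]
    exact Subgroup.relIndex_dvd_index_of_normal _ _
theorem aux_descent {A B : Type*} [CommRing A] [CommRing B] [Algebra A B] (σ : B →+* B)
    (hinv : ∀ b, σ (σ b) = b)
    (hfix : ∀ b, σ b = b → ∃ a, algebraMap A B a = b)
    (I : Ideal B) (hI : ∀ b ∈ I, σ b ∈ I)
    (hgood : ∀ p : Ideal A, p.IsMaximal → ∃ y d, algebraMap A B d = (y - σ y) ^ 2 ∧ d ∉ p) :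
    (I.comap (algebraMap A B)).map (algebraMap A B) = I := by
  apply le_antisymm Ideal.map_comap_le
  set J := (I.comap (algebraMap A B)).map (algebraMap A B) with hJ
  have htr : ∀ x ∈ I, x + σ x ∈ J := by
    intro x hx
    obtain ⟨a, ha⟩ := hfix (x + σ x) (by rw [map_add, hinv, add_comm])
    rw [← ha]
    apply Ideal.mem_map_of_mem
    rw [Ideal.mem_comap, ha]
    exact I.add_mem hx (hI x hx)
  have hkey : ∀ x ∈ I, ∀ y, x * (y - σ y) ∈ J := by
    intro x hx y
    have h1 := htr (x * y) (I.mul_mem_right _ hx)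
    have h2 := J.mul_mem_right (σ y) (htr x hx)
    have := J.sub_mem h1 h2
    convert this using 1
    rw [map_mul]
    ring
  let T : Ideal A :=
    { carrier := {c | ∀ x ∈ I, algebraMap A B c * x ∈ J}
      add_mem' := by
        intro a b ha hb x hx
        rw [map_add, add_mul]
        exact J.add_mem (ha x hx) (hb x hx)
      zero_mem' := by intro x hx; simp
      smul_mem' := by
        intro c a ha x hx
        rw [smul_eq_mul, map_mul, mul_assoc]
        exact J.mul_mem_left _ (ha x hx) }
  have hT : T = ⊤ := by
    by_contra hT
    obtain ⟨p, hp, hle⟩ := T.exists_le_maximal hT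
    obtain ⟨y, d, hd, hdp⟩ := hgood p hp
    apply hdp
    apply hle
    intro x hx
    rw [hd]
    have := J.mul_mem_left (y - σ y) (hkey x hx y)
    convert this using 1
    ring
  intro x hx
  have h1 : (1 : A) ∈ T := by rw [hT]; trivial
  simpa using h1 x hx

theorem aux_principal {A : Type*} [CommRing A] [IsDedekindDomain A]
    [Fintype (ClassGroup A)]
    (hodd : Odd (Fintype.card (ClassGroup A))) (J : Ideal A) (hJ : J ≠ ⊥)
    (h2 : (J ^ 2).IsPrincipal) : J.IsPrincipal := by
  have hJ0 : J ∈ nonZeroDivisors (Ideal A) := mem_nonZeroDivisors_of_ne_zero hJ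
  rw [← ClassGroup.mk0_eq_one_iff hJ0]
  have h3 : ClassGroup.mk0 ⟨J, hJ0⟩ ^ 2 = 1 := by
    rw [← map_pow]
    exact (ClassGroup.mk0_eq_one_iff (I := J ^ 2) (pow_mem hJ0 2)).2 h2
  have h4 := pow_card_eq_one (x := ClassGroup.mk0 ⟨J, hJ0⟩)
  obtain ⟨k, hk⟩ := hodd
  rw [hk, pow_succ, pow_mul, h3, one_pow, one_mul] at h4
  exact h4

/-- good -/
def Good (F : Type*) [Field F] [NumberField F] (p : Ideal (𝓞 F)) (γ : F) : Prop :=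
  ∃ (a b : 𝓞 F) (c : F), algebraMap (𝓞 F) F (a ^ 2 - 4 * b) = γ * c ^ 2 ∧ a ^ 2 - 4 * b ∉ p

section
variable {F K : Type*} [Field F] [Field K] [NumberField F] [NumberField K] [Algebra F K] {γ : F}
  (S : QSetup F K γ)
include S

theorem QSetup.smul_coe (y : 𝓞 K) : ((S.σ • y : 𝓞 K) : K) = S.σ (y : K) := rfl

theorem QSetup.fixedInt (y : 𝓞 K) (h : S.σ • y = y) : ∃ a : 𝓞 F, algebraMap (𝓞 F) (𝓞 K) a = y := by
  have h1 : S.σ (y : K) = y := by rw [← S.smul_coe, h]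
  obtain ⟨r, hr⟩ := S.fixed _ h1
  have hint : IsIntegral ℤ r := by
    rw [← isIntegral_algebraMap_iff (algebraMap F K).injective, hr]
    exact y.isIntegral_coe
  refine ⟨⟨r, hint⟩, ?_⟩
  apply RingOfIntegers.ext
  exact hr

theorem QSetup.involInt (y : 𝓞 K) : S.σ • S.σ • y = y := by
  apply RingOfIntegers.ext
  rw [S.smul_coe, S.smul_coe, S.invol]

theorem QSetup.smul_algebraMap (a : 𝓞 F) :
    S.σ • algebraMap (𝓞 F) (𝓞 K) a = algebraMap (𝓞 F) (𝓞 K) a := by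
  apply RingOfIntegers.ext
  rw [S.smul_coe]
  exact S.σ.commutes _

theorem QSetup.good_iff (p : Ideal (𝓞 F)) :
    Good F p γ ↔ ∃ (y : 𝓞 K) (d : 𝓞 F), algebraMap (𝓞 F) (𝓞 K) d = (y - S.σ • y) ^ 2 ∧ d ∉ p := by
  constructor
  · rintro ⟨a, b, c, h, hp⟩
    let y : K := (algebraMap F K a + algebraMap F K c * S.x) / 2
    have h' := congrArg (algebraMap F K) h
    simp only [map_sub, map_mul, map_pow, map_ofNat] at h'
    rw [← S.hx] at h'
    have hy : y ^ 2 - algebraMap F K a * y + algebraMap F K b = 0 := by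
      simp only [y]
      linear_combination -h' / 4
    have hyint : IsIntegral ℤ y := by
      have h1 : IsIntegral (𝓞 F) y := by
        refine ⟨Polynomial.X ^ 2 - Polynomial.C a * Polynomial.X + Polynomial.C b, ?_, ?_⟩
        · monicity!
        · simp only [Polynomial.eval₂_add, Polynomial.eval₂_sub, Polynomial.eval₂_pow,
            Polynomial.eval₂_X, Polynomial.eval₂_mul, Polynomial.eval₂_C]
          exact hy
      exact isIntegral_trans y h1
    refine ⟨⟨y, hyint⟩, a ^ 2 - 4 * b, ?_, hp⟩
    apply RingOfIntegers.ext
    have e1 : (((⟨y, hyint⟩ - S.σ • ⟨y, hyint⟩ : 𝓞 K) ^ 2 : 𝓞 K) : K) = (y - S.σ y) ^ 2 := rfl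
    rw [e1]
    have e2 : S.σ y = (algebraMap F K a - algebraMap F K c * S.x) / 2 := by
      simp [y, S.hσ, sub_eq_add_neg, map_ofNat S.σ 2]
    have e3 : ((algebraMap (𝓞 F) (𝓞 K) (a ^ 2 - 4 * b) : 𝓞 K) : K) =
      algebraMap F K (algebraMap (𝓞 F) F (a ^ 2 - 4 * b)) := rfl
    rw [e2, e3]
    simp only [map_sub, map_mul, map_pow, map_ofNat]
    rw [h']
    simp only [y]
    ring
  · rintro ⟨y, d, hd, hp⟩
    obtain ⟨a, ha⟩ := S.fixedInt (y + S.σ • y) (by rw [smul_add, S.involInt, add_comm])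
    obtain ⟨b, hb⟩ := S.fixedInt (y * S.σ • y) (by rw [smul_mul', S.involInt, mul_comm])
    have hdab : d = a ^ 2 - 4 * b := by
      apply FaithfulSMul.algebraMap_injective (𝓞 F) (𝓞 K)
      simp only [map_sub, map_mul, map_pow, map_ofNat]
      rw [hd, ha, hb]
      ring
    obtain ⟨r, s, hrs⟩ := S.dec (y : K)
    refine ⟨a, b, 2 * s, ?_, hdab ▸ hp⟩
    rw [← hdab]
    apply (algebraMap F K).injective
    have e3 : algebraMap F K (algebraMap (𝓞 F) F d) = ((algebraMap (𝓞 F) (𝓞 K) d : 𝓞 K) : K) := rfl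
    rw [e3, hd]
    have e1 : (((y - S.σ • y : 𝓞 K) ^ 2 : 𝓞 K) : K) = ((y : K) - S.σ y) ^ 2 := rfl
    rw [e1, hrs]
    simp [S.hσ, ← S.hx, map_ofNat (algebraMap F K) 2]
    ring

theorem QSetup.exists_fixed (ε : 𝓞 K) (hε : ε * S.σ • ε = 1) :
    ∃ a : 𝓞 K, a ≠ 0 ∧ a = ε * S.σ • a := by
  by_cases h : ε = -1
  · obtain ⟨n, d, hd, hnd⟩ := IsFractionRing.div_surjective (A := 𝓞 F) γ
    have hd0 : algebraMap (𝓞 F) F d ≠ 0 := by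
      simpa using nonZeroDivisors.ne_zero hd
    let z : K := algebraMap F K d * S.x
    have hz : IsIntegral ℤ z := by
      apply IsIntegral.of_pow (n := 2) (by norm_num)
      have : z ^ 2 = ((algebraMap (𝓞 F) (𝓞 K) (n * d) : 𝓞 K) : K) := by
        have e3 : ((algebraMap (𝓞 F) (𝓞 K) (n * d) : 𝓞 K) : K) =
          algebraMap F K (algebraMap (𝓞 F) F (n * d)) := rfl
        rw [e3]
        simp only [z, mul_pow, S.hx]
        rw [← map_pow, ← map_mul]
        congr 1
        rw [map_mul, ← hnd]
        field_simp
      rw [this]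
      exact RingOfIntegers.isIntegral_coe _
    refine ⟨⟨z, hz⟩, ?_, ?_⟩
    · intro h0
      have : z = 0 := congrArg (fun t : 𝓞 K => (t : K)) h0
      have h3 : algebraMap F K (algebraMap (𝓞 F) F d) ≠ 0 := by simpa using hd0
      exact mul_ne_zero h3 S.x_ne this
    · apply RingOfIntegers.ext
      rw [h]
      change z = (-1 : K) * S.σ z
      simp [z, S.hσ]
  · refine ⟨1 + ε, ?_, ?_⟩
    · intro h0
      exact h (by linear_combination h0)
    · rw [smul_add, smul_one]
      linear_combination -hε

theorem QSetup.hilbert (hodd : Odd (NumberField.classNumber F))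
    (hgood : ∀ p : Ideal (𝓞 F), p.IsMaximal → Good F p γ) (hdeg : Module.finrank F K = 2)
    (ε : 𝓞 K) (hε : ε * S.σ • ε = 1) :
    ∃ u : (𝓞 K)ˣ, (u : 𝓞 K) = ε * S.σ • (u : 𝓞 K) := by
  obtain ⟨a, ha0, ha⟩ := S.exists_fixed ε hε
  have hσa : S.σ • a = S.σ • ε * a := by
    conv_lhs => rw [ha]
    rw [smul_mul', S.involInt]
  have hI := aux_descent (A := 𝓞 F) (MulSemiringAction.toRingHom _ (𝓞 K) S.σ) S.involInt S.fixedInt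
    (Ideal.span {a}) (by
      intro b hb
      obtain ⟨c, rfl⟩ := Ideal.mem_span_singleton'.1 hb
      change S.σ • (c * a) ∈ _
      rw [smul_mul', hσa, ← mul_assoc]
      exact Ideal.mul_mem_left _ _ (Ideal.mem_span_singleton_self a))
    (fun p hp => (S.good_iff p).1 (hgood p hp))
  set J := (Ideal.span {a}).comap (algebraMap (𝓞 F) (𝓞 K)) with hJ
  have hJ2 : J ^ 2 = Ideal.span {Algebra.intNorm (𝓞 F) (𝓞 K) a} := by
    rw [← Ideal.relNorm_singleton, ← hI, Ideal.relNorm_algebraMap (𝓞 K), ← Algebra.IsAlgebraic.finrank_of_isFractionRing (𝓞 F) F (𝓞 K) K, hdeg]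
  have hJ0 : J ≠ ⊥ := by
    intro h
    rw [h, Ideal.map_bot] at hI
    exact ha0 (Ideal.span_singleton_eq_bot.1 hI.symm)
  have hp : J.IsPrincipal := aux_principal hodd J hJ0 ⟨⟨_, hJ2⟩⟩
  obtain ⟨⟨b, hb⟩⟩ := hp
  have hb' : J = Ideal.span {b} := hb
  rw [hb', Ideal.map_span, Set.image_singleton, Ideal.span_singleton_eq_span_singleton] at hI
  obtain ⟨u, hu⟩ := hI
  have hb0 : algebraMap (𝓞 F) (𝓞 K) b ≠ 0 := by
    intro h
    rw [h, zero_mul] at hu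
    exact ha0 hu.symm
  refine ⟨u, ?_⟩
  apply mul_left_cancel₀ hb0
  rw [hu]
  conv_lhs => rw [ha, ← hu, smul_mul', S.smul_algebraMap]
  ring

end
theorem aux_index_mul (G : Type*) [CommGroup G] [Module.Finite ℤ (Additive G)] :
    (powMonoidHom (α := G) 2).range.index =
      2 ^ Module.finrank ℤ (Additive G) * Nat.card {g : G // g ^ 2 = 1} := by
  have h := aux_index_two (Additive G)
  have h1 : (powMonoidHom (α := G) 2).range.index =
      (AddMonoidHom.range (nsmulAddMonoidHom (α := Additive G) 2)).index := by
    rw [← Subgroup.index_toAddSubgroup]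
    rfl
  rw [h1, h]
  congr 1

theorem aux_ker_rank {E e : Type*} [CommGroup E] [CommGroup e] [Module.Finite ℤ (Additive E)]
    [Module.Finite ℤ (Additive e)] (N : E →* e) :
    Module.Finite ℤ (Additive N.ker) ∧ Module.finrank ℤ (Additive E) ≤
      Module.finrank ℤ (Additive e) + Module.finrank ℤ (Additive N.ker) := by
  let f : Additive E →ₗ[ℤ] Additive e := (MonoidHom.toAdditive N).toIntLinearMap
  let g : Additive N.ker ≃+ f.ker :=
    { toFun := fun x => ⟨Additive.ofMul (x.toMul : E), x.toMul.2⟩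
      invFun := fun x => Additive.ofMul ⟨x.1.toMul, x.2⟩
      left_inv := fun x => rfl
      right_inv := fun x => rfl
      map_add' := fun x y => rfl }
  let g' : Additive N.ker ≃ₗ[ℤ] f.ker := g.toIntLinearEquiv
  refine ⟨Module.Finite.equiv g'.symm, ?_⟩
  rw [g'.finrank_eq, ← aux_rank_nullity f]
  gcongr
  exact Submodule.finrank_le _

section
variable {F K : Type*} [Field F] [Field K] [NumberField F] [NumberField K] [Algebra F K] {γ : F}
  (S : QSetup F K γ)
include S

theorem QSetup.unramInf (hpos : ∀ φ : F →+* ℝ, 0 < φ γ) : IsUnramifiedAtInfinitePlaces F K := by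
  refine ⟨fun w => ?_⟩
  rw [InfinitePlace.isUnramified_iff]
  by_cases hc : (w.comap (algebraMap F K)).IsComplex
  · exact Or.inr hc
  left
  rw [InfinitePlace.not_isComplex_iff_isReal] at hc
  rw [InfinitePlace.isReal_iff]
  have hw : w.comap (algebraMap F K) = InfinitePlace.mk (w.embedding.comp (algebraMap F K)) := by
    rw [← InfinitePlace.comap_mk, InfinitePlace.mk_embedding]
  rw [hw, InfinitePlace.isReal_mk_iff] at hc
  set φ : F →+* ℝ := hc.embedding with hφ
  have hφ' : ∀ r : F, w.embedding (algebraMap F K r) = (φ r : ℂ) := by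
    intro r
    rw [hφ, ComplexEmbedding.IsReal.coe_embedding_apply]
    rfl
  have hxsq : w.embedding S.x ^ 2 = ((Real.sqrt (φ γ) : ℝ) : ℂ) ^ 2 := by
    rw [← map_pow, S.hx, hφ', ← Complex.ofReal_pow, Real.sq_sqrt (hpos φ).le]
  have hxr : ∃ t : ℝ, w.embedding S.x = t := by
    rcases sq_eq_sq_iff_eq_or_eq_neg.1 hxsq with h | h
    · exact ⟨_, h⟩
    · exact ⟨-Real.sqrt (φ γ), by rw [h]; simp⟩
  obtain ⟨t, ht⟩ := hxr
  rw [ComplexEmbedding.isReal_iff]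
  ext y
  obtain ⟨r, s, rfl⟩ := S.dec y
  rw [ComplexEmbedding.conjugate_coe_eq]
  simp only [map_add, map_mul, hφ', ht, Complex.conj_ofReal]

theorem QSetup.isGal (hdeg : Module.finrank F K = 2) : IsGalois F K := by
  have : Algebra.IsQuadraticExtension F K := ⟨hdeg⟩
  infer_instance

theorem QSetup.contra (hdeg : Module.finrank F K = 2) (hodd : Odd (NumberField.classNumber F))
    (hgood : ∀ p : Ideal (𝓞 F), p.IsMaximal → Good F p γ)
    (hpos : ∀ φ : F →+* ℝ, 0 < φ γ) : False := by
  have := S.unramInf hpos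
  have := S.isGal hdeg
  have hcard := IsUnramifiedAtInfinitePlaces.card_infinitePlace F K
  have hrk : Units.rank K = 2 * Units.rank F + 1 := by
    have h0 : 0 < Fintype.card (InfinitePlace F) := Fintype.card_pos
    simp only [Units.rank]
    rw [hdeg] at hcard
    omega
  have hnorm : ∀ y : K, algebraMap F K (Algebra.norm F y) = y * S.σ y := by
    intro y
    classical
    rw [Algebra.norm_eq_prod_automorphisms]
    have : (Finset.univ : Finset (K ≃ₐ[F] K)) = {1, S.σ} := by
      ext g
      simpa using S.eq_one_or g
    rw [this, Finset.prod_pair S.ne_one.symm]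
    rfl
  have hN : ∀ y : 𝓞 K, algebraMap (𝓞 F) (𝓞 K) (RingOfIntegers.norm F y) = y * S.σ • y := by
    intro y
    apply RingOfIntegers.ext
    exact hnorm y
  have hinj := FaithfulSMul.algebraMap_injective (𝓞 F) (𝓞 K)
  let N : (𝓞 K)ˣ →* (𝓞 F)ˣ := Units.map (RingOfIntegers.norm F)
  let ι : (𝓞 F)ˣ →* (𝓞 K)ˣ := Units.map (algebraMap (𝓞 F) (𝓞 K)).toMonoidHom
  let τ : (𝓞 K)ˣ →* (𝓞 K)ˣ := Units.map (MulSemiringAction.toRingHom _ (𝓞 K) S.σ).toMonoidHom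
  have hNv : ∀ u : (𝓞 K)ˣ, ((N u : (𝓞 F)ˣ) : 𝓞 F) = RingOfIntegers.norm F (u : 𝓞 K) := fun u => rfl
  have hιv : ∀ u : (𝓞 F)ˣ, ((ι u : (𝓞 K)ˣ) : 𝓞 K) = algebraMap (𝓞 F) (𝓞 K) u := fun u => rfl
  have hτv : ∀ u : (𝓞 K)ˣ, ((τ u : (𝓞 K)ˣ) : 𝓞 K) = S.σ • (u : 𝓞 K) := fun u => rfl
  have hdvd := aux_count N ι τ
    (by intro u; ext1; rw [hιv, hNv, hN, Units.val_mul, hτv])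
    (by
      intro v; ext1; apply hinj
      rw [hNv, hN, hιv, S.smul_algebraMap, Units.val_pow_eq_pow_val, map_pow, sq])
    (by intro v; ext1; rw [hτv, hιv, S.smul_algebraMap])
    (by intro u; ext1; apply hinj; rw [hNv, hNv, hN, hN, hτv, S.involInt, mul_comm])
    (by
      intro ε hε
      obtain ⟨u, hu⟩ := S.hilbert hodd hgood hdeg ε (by
        rw [← hN, ← hNv, hε]; simp)
      exact ⟨u, Units.ext (by rw [hu, Units.val_mul, hτv])⟩)
  obtain ⟨hfin, hle⟩ := aux_ker_rank N
  rw [Units.finrank_eq, Units.finrank_eq, hrk] at hle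
  rw [aux_index_mul, aux_index_mul, Units.finrank_eq] at hdvd
  have he : Nat.card {g : (𝓞 F)ˣ // g ^ 2 = 1} = 2 := by
    have : {g : (𝓞 F)ˣ | g ^ 2 = 1} = {1, -1} := by
      ext g
      simp only [Set.mem_setOf_eq, Set.mem_insert_iff, Set.mem_singleton_iff]
      constructor
      · intro h
        have h2 : (g : 𝓞 F) ^ 2 = 1 := by rw [← Units.val_pow_eq_pow_val, h]; rfl
        rcases sq_eq_sq_iff_eq_or_eq_neg.1 (h2.trans (one_pow 2).symm) with h | h
        · left; ext1; simpa using h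
        · right; ext1; simpa using h
      · rintro (rfl | rfl) <;> simp
    have h2 := congrArg Set.ncard this
    rw [Set.ncard_pair] at h2
    · exact h2
    · intro h
      have := congrArg (fun u : (𝓞 F)ˣ => (u : 𝓞 F)) h
      simp at this
      norm_num [eq_neg_iff_add_eq_zero] at this
  rw [he] at hdvd
  have hpos2 : 0 < Nat.card {g : N.ker // g ^ 2 = 1} := by
    by_contra h0
    have h0 : Nat.card {g : N.ker // g ^ 2 = 1} = 0 := by omega
    rw [h0, mul_zero, zero_dvd_iff] at hdvd
    simp at hdvd
  have hfin2 : Finite {g : N.ker // g ^ 2 = 1} := (Nat.card_pos_iff.1 hpos2).2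
  have hge : 2 ≤ Nat.card {g : N.ker // g ^ 2 = 1} := by
    have hm : (-1 : (𝓞 K)ˣ) ∈ N.ker := by
      rw [MonoidHom.mem_ker]
      ext1; apply hinj
      rw [hNv, hN]
      simp
    have : Nontrivial {g : N.ker // g ^ 2 = 1} := by
      refine ⟨⟨1, by simp⟩, ⟨⟨-1, hm⟩, by ext1; simp⟩, ?_⟩
      intro h
      have := congrArg (fun u : {g : N.ker // g ^ 2 = 1} => ((u.1 : (𝓞 K)ˣ) : 𝓞 K)) h
      simp at this
      norm_num [eq_neg_iff_add_eq_zero] at this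
    exact Finite.one_lt_card
  have h1 := Nat.le_of_dvd (by positivity) hdvd
  have h2 : 2 ^ (Units.rank F + 1) ≤ 2 ^ Module.finrank ℤ (Additive N.ker) :=
    Nat.pow_le_pow_right (by norm_num) (by omega)
  have h3 := Nat.mul_le_mul h2 hge
  have h4 : 0 < 2 ^ Units.rank F := by positivity
  rw [pow_succ] at h3
  omega

end
section
variable {F K : Type*} [Field F] [Field K] [NumberField F] [NumberField K] [Algebra F K] {γ : F}
  (S : QSetup F K γ)
include S

theorem QSetup.sq_dvd_iff (hdeg : Module.finrank F K = 2) (p : Ideal (𝓞 F)) [hp : p.IsPrime]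
    (hp0 : p ≠ ⊥) (P : Ideal (𝓞 K)) [hP : P.IsPrime] [hl : P.LiesOver p] :
    P ^ 2 ∣ p.map (algebraMap (𝓞 F) (𝓞 K)) ↔ ∀ y : 𝓞 K, S.σ • y - y ∈ P := by
  have : Algebra.IsQuadraticExtension F K := ⟨hdeg⟩
  have : IsGalois F K := inferInstance
  have : p.IsMaximal := hp.isMaximal hp0
  have : Finite (𝓞 F ⧸ p) := Ring.HasFiniteQuotients.finiteQuotient hp0
  have hmap : p.map (algebraMap (𝓞 F) (𝓞 K)) ≠ ⊥ := Ideal.map_ne_bot_of_ne_bot hp0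
  have h1 := Ideal.card_inertia_eq_ramificationIdxIn (G := K ≃ₐ[F] K) p P
  rw [Ideal.ramificationIdxIn_eq_ramificationIdx p P (K ≃ₐ[F] K),
    Ideal.IsDedekindDomain.ramificationIdx_eq_multiplicity p P hmap] at h1
  have hP0 : P ≠ ⊥ := ne_bot_of_le_ne_bot hmap (Ideal.map_le_of_le_comap (P.over_def p).le)
  have hfm : FiniteMultiplicity P (p.map (algebraMap (𝓞 F) (𝓞 K))) :=
    FiniteMultiplicity.of_not_isUnit (by
      rw [Ideal.isUnit_iff]; exact hP.ne_top) hmap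
  rw [hfm.pow_dvd_iff_le_multiplicity, ← h1]
  have h3 : (∀ y : 𝓞 K, S.σ • y - y ∈ P) ↔ S.σ ∈ Ideal.inertia (K ≃ₐ[F] K) P := Iff.rfl
  rw [h3]
  constructor
  · intro h
    have : Nontrivial (Ideal.inertia (K ≃ₐ[F] K) P) := (Finite.one_lt_card_iff_nontrivial).1 h
    obtain ⟨⟨g, hg⟩, hne⟩ := exists_ne (1 : Ideal.inertia (K ≃ₐ[F] K) P)
    rcases S.eq_one_or g with h | h
    · exact absurd (Subtype.ext h) hne
    · exact h ▸ hg
  · intro h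
    have : Nontrivial (Ideal.inertia (K ≃ₐ[F] K) P) :=
      ⟨⟨S.σ, h⟩, 1, fun h => S.ne_one (congrArg Subtype.val h)⟩
    exact Finite.one_lt_card

theorem QSetup.ram_iff (hdeg : Module.finrank F K = 2) (p : Ideal (𝓞 F)) (hp : p.IsPrime)
    (hp0 : p ≠ ⊥) : IsRamifiedIn F K p ↔ ¬ Good F p γ := by
  rw [S.good_iff]
  have hmax : p.IsMaximal := hp.isMaximal hp0
  constructor
  · rintro ⟨P, hP, hdvd⟩ ⟨y, d, hd, hdp⟩
    have hle : p.map (algebraMap (𝓞 F) (𝓞 K)) ≤ P :=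
      (Ideal.le_of_dvd hdvd).trans (Ideal.pow_le_self two_ne_zero)
    have hl : P.LiesOver p := ⟨(hmax.eq_of_le (Ideal.IsPrime.under (𝓞 F) P).ne_top
      (Ideal.map_le_iff_le_comap.1 hle))⟩
    rw [S.sq_dvd_iff hdeg p hp0 P] at hdvd
    apply hdp
    rw [P.over_def p]
    change algebraMap (𝓞 F) (𝓞 K) d ∈ P
    rw [hd]
    have := P.mul_mem_left (S.σ • y - y) (hdvd y)
    convert this using 1
    ring
  · intro h
    obtain ⟨P, hP, hl⟩ := Ideal.exists_maximal_ideal_liesOver_of_isIntegral (S := 𝓞 K) p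
    refine ⟨P, hP.isPrime, ?_⟩
    have := hP.isPrime
    rw [S.sq_dvd_iff hdeg p hp0 P]
    intro y
    obtain ⟨d, hd⟩ := S.fixedInt ((y - S.σ • y) ^ 2) (by
      rw [smul_pow', smul_sub, S.involInt]; ring)
    have hdp : d ∈ p := by
      by_contra hdp
      exact h ⟨y, d, hd, hdp⟩
    rw [P.over_def p] at hdp
    change algebraMap (𝓞 F) (𝓞 K) d ∈ P at hdp
    rw [hd] at hdp
    have := this.mem_of_pow_mem _ hdp
    rw [← P.neg_mem_iff, neg_sub]
    exact this

end

theorem Good.mul {F : Type*} [Field F] [NumberField F] {p : Ideal (𝓞 F)} (hp : p.IsPrime)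
    {α β : F} (h1 : Good F p α) (h2 : Good F p β) : Good F p (α * β) := by
  obtain ⟨a, b, c, h, hn⟩ := h1
  obtain ⟨a', b', c', h', hn'⟩ := h2
  have e : (a * a') ^ 2 - 4 * (a ^ 2 * b' + a' ^ 2 * b - 4 * b * b') =
    (a ^ 2 - 4 * b) * (a' ^ 2 - 4 * b') := by ring
  refine ⟨a * a', a ^ 2 * b' + a' ^ 2 * b - 4 * b * b', c * c', ?_, ?_⟩
  · rw [e, map_mul, h, h']; ring
  · rw [e]
    intro h
    rcases hp.mem_or_mem h with h | h
    · exact hn h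
    · exact hn' h

open IsDedekindDomain in
theorem good_of_even {F : Type*} [Field F] [NumberField F] (v : HeightOneSpectrum (𝓞 F))
    (h2 : (2 : 𝓞 F) ∉ v.asIdeal) {γ c : F} (h : v.valuation F (γ * c ^ 2) = 1) :
    Good F v.asIdeal γ := by
  obtain ⟨n, d, hd⟩ := v.exists_primeCompl_mul_eq_of_integer (K := F) _ h.le
  have hdp : (d : 𝓞 F) ∉ v.asIdeal := d.2
  have hval : ∀ r : 𝓞 F, r ∉ v.asIdeal ↔ v.valuation F (algebraMap (𝓞 F) F r) = 1 := by
    intro r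
    rw [← v.valuation_lt_one_iff_mem (K := F), not_lt]
    exact ⟨fun h => le_antisymm (v.valuation_le_one r) h, fun h => h.ge⟩
  have hnp : n ∉ v.asIdeal := by
    rw [hval, ← hd, map_mul, h, (hval _).1 hdp, one_mul]
  refine ⟨0, -(n * d), 2 * c * algebraMap (𝓞 F) F d, ?_, ?_⟩
  · simp only [map_sub, map_mul, map_pow, map_ofNat, map_zero, map_neg]
    rw [← hd]
    ring
  · have e : (0 : 𝓞 F) ^ 2 - 4 * -(n * d) = 2 * 2 * (n * d) := by ring
    rw [e]
    have hp := v.isPrime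
    intro h
    rcases hp.mem_or_mem h with h | h
    · rcases hp.mem_or_mem h with h | h <;> exact h2 h
    · rcases hp.mem_or_mem h with h | h
      · exact hnp h
      · exact hdp h

open IsDedekindDomain in
theorem good_of_not {F : Type*} [Field F] [NumberField F] {p : Ideal (𝓞 F)} (hp : p.IsPrime)
    (hp0 : p ≠ ⊥) (h2 : (2 : 𝓞 F) ∉ p) {α β : F} (hα : α ≠ 0) (hβ : β ≠ 0)
    (h1 : ¬ Good F p α) (h3 : ¬ Good F p β) : Good F p (α * β) := by
  let v : HeightOneSpectrum (𝓞 F) := ⟨p, hp, hp0⟩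
  obtain ⟨π, hπ⟩ := v.valuation_exists_uniformizer F
  have hexp : ∀ γ : F, γ ≠ 0 → ∃ k : ℤ, v.valuation F γ = WithZero.exp k := by
    intro γ hγ
    have : v.valuation F γ ≠ 0 := by simpa using hγ
    exact ⟨WithZero.log (v.valuation F γ), (WithZero.exp_log this).symm⟩
  have hev : ∀ (γ : F) (k : ℤ), v.valuation F γ = WithZero.exp (2 * k) → Good F p γ := by
    intro γ k hk
    refine good_of_even v h2 (c := π ^ k) ?_
    rw [map_mul, hk, map_pow, map_zpow₀, hπ, ← WithZero.exp_zsmul, ← WithZero.exp_nsmul, ← WithZero.exp_add]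
    simp
  obtain ⟨k, hk⟩ := hexp α hα
  obtain ⟨l, hl⟩ := hexp β hβ
  rcases Int.even_or_odd' k with ⟨k', rfl | rfl⟩
  · exact absurd (hev _ _ hk) h1
  rcases Int.even_or_odd' l with ⟨l', rfl | rfl⟩
  · exact absurd (hev _ _ hl) h3
  refine hev _ (k' + l' + 1) ?_
  rw [map_mul, hk, hl, ← WithZero.exp_add]
  congr 1
  ring
theorem aux_root {F : Type*} [Field F] (a : F) :
    (⟨0, 1⟩ : QuadraticAlgebra F a 0) ^ 2 = algebraMap F (QuadraticAlgebra F a 0) a := by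
  rw [sq]
  ext <;> simp

theorem aux_root' {F : Type*} [Field F] (a : F) (r : F) :
    algebraMap F (QuadraticAlgebra F a 0) r ≠ ⟨0, 1⟩ := by
  intro h
  have := congrArg QuadraticAlgebra.im h
  simp at this

/-- Uniqueness in the first supplementary law: if `F` has odd class number and
`𝔞` is a squarefree ideal of odd norm, two quadratic extensions of `F` ramified
exactly at the primes dividing `𝔞` (and unramified at infinity) coincide, i.e.
they are isomorphic as `F`-algebras. -/
theorem first_supplementary_law_uniqueness
    (F : Type*) [Field F] [NumberField F]
    (hodd : Odd (NumberField.classNumber F))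
    (𝔞 : Ideal (𝓞 F)) (hsf : Squarefree 𝔞) (hoddN : Odd (Ideal.absNorm 𝔞))
    (K : Type*) [Field K] [NumberField K] [Algebra F K]
    (hdegK : Module.finrank F K = 2)
    (hramK : ∀ 𝔭 : Ideal (𝓞 F), 𝔭.IsPrime → 𝔭 ≠ ⊥ → (IsRamifiedIn F K 𝔭 ↔ 𝔭 ∣ 𝔞))
    (hinfK : UnramifiedAtInfinitePlaces F K)
    (K' : Type*) [Field K'] [NumberField K'] [Algebra F K']
    (hdegK' : Module.finrank F K' = 2)
    (hramK' : ∀ 𝔭 : Ideal (𝓞 F), 𝔭.IsPrime → 𝔭 ≠ ⊥ → (IsRamifiedIn F K' 𝔭 ↔ 𝔭 ∣ 𝔞))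
    (hinfK' : UnramifiedAtInfinitePlaces F K') :
    Nonempty (K ≃ₐ[F] K') := by
  have h2p : ∀ p : Ideal (𝓞 F), p.IsPrime → p ∣ 𝔞 → (2 : 𝓞 F) ∉ p := by
    intro p hp hdvd h2
    have h1 : ((Ideal.absNorm 𝔞 : ℕ) : 𝓞 F) ∈ p := Ideal.le_of_dvd hdvd (Ideal.absNorm_mem 𝔞)
    obtain ⟨k, hk⟩ := hoddN
    rw [hk] at h1
    push_cast at h1
    apply hp.ne_top
    rw [Ideal.eq_top_iff_one]
    have := p.sub_mem h1 (p.mul_mem_right (k : 𝓞 F) h2)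
    convert this using 1
    ring
  obtain ⟨α, x, hx, hnx⟩ := aux_exists_sqrt hdegK
  obtain ⟨β, x', hx', hnx'⟩ := aux_exists_sqrt hdegK'
  obtain ⟨S⟩ := aux_setup hdegK α x hx hnx
  obtain ⟨S'⟩ := aux_setup hdegK' β x' hx' hnx'
  by_cases hsq : ∃ c : F, c ^ 2 = α * β
  · obtain ⟨c, hc⟩ := hsq
    have hβ := S'.g_ne
    have hα := S.g_ne
    have hc0 : c ≠ 0 := by
      intro h
      rw [h] at hc
      exact mul_ne_zero hα hβ (by rw [← hc]; simp)
    have hcβ : c / β ≠ 0 := div_ne_zero hc0 hβ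
    obtain ⟨e, -⟩ := aux_quadEquiv hdegK α x hx hnx
    obtain ⟨e', -⟩ := aux_quadEquiv hdegK' α (algebraMap F K' (c / β) * x') (by
      rw [mul_pow, hx', ← map_pow, ← map_mul]
      have e0 : (c / β) ^ 2 * β = α := by
        rw [div_pow, hc]
        field_simp
      rw [e0]) (by
      intro r hr
      apply hnx' (r / (c / β))
      rw [map_div₀, hr]
      have : algebraMap F K' (c / β) ≠ 0 := by simpa using hcβ
      field_simp)
    exact ⟨e.symm.trans e'⟩
  · exfalso
    have hfact : Fact (∀ r : F, r ^ 2 ≠ α * β + 0 * r) := ⟨fun r hr => hsq ⟨r, by simpa using hr⟩⟩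
    let L := QuadraticAlgebra F (α * β) 0
    have hdegL : Module.finrank F L = 2 := QuadraticAlgebra.finrank_eq_two _ _
    have : FiniteDimensional F L := Module.finite_of_finrank_eq_succ hdegL
    have : NumberField L := NumberField.of_module_finite F L
    let xL : L := ⟨0, 1⟩
    have hxL : xL ^ 2 = algebraMap F L (α * β) := by
      exact aux_root (α * β)
    have hnxL : ∀ r : F, algebraMap F L r ≠ xL := by
      intro r hr
      exact aux_root' (α * β) r hr
    obtain ⟨T⟩ := aux_setup hdegL (α * β) xL hxL hnxL
    refine T.contra hdegL hodd ?_ ?_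
    · intro p hp
      have hpp := hp.isPrime
      have hp0 : p ≠ ⊥ := Ring.ne_bot_of_isMaximal_of_not_isField hp (RingOfIntegers.not_isField F)
      have r1 := (S.ram_iff hdegK p hpp hp0).symm.trans (hramK p hpp hp0)
      have r2 := (S'.ram_iff hdegK' p hpp hp0).symm.trans (hramK' p hpp hp0)
      by_cases hd : p ∣ 𝔞
      · exact good_of_not hpp hp0 (h2p p hpp hd) S.g_ne S'.g_ne (r1.2 hd) (r2.2 hd)
      · exact Good.mul hpp (by_contra fun h => hd (r1.1 h)) (by_contra fun h => hd (r2.1 h))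
    · intro φ
      obtain ⟨ψ, hψ⟩ := hinfK φ
      obtain ⟨ψ', hψ'⟩ := hinfK' φ
      have e1 : φ α = ψ x ^ 2 := by rw [← map_pow, hx, ← hψ]; rfl
      have e2 : φ β = ψ' x' ^ 2 := by rw [← map_pow, hx', ← hψ']; rfl
      have n1 : φ α ≠ 0 := by simpa using S.g_ne
      have n2 : φ β ≠ 0 := by simpa using S'.g_ne
      rw [map_mul]
      apply mul_pos
      · exact lt_of_le_of_ne (e1 ▸ sq_nonneg _) n1.symm
      · exact lt_of_le_of_ne (e2 ▸ sq_nonneg _) n2.symm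
end

section
/- Let F be a number field with odd class number and unit group E_F, and let k/F be a quadratic extension in which exactly two prime ideals 𝔭₁ and 𝔭₂ of odd norm ramify (and which is unramified at all primes above 2 and at all infinite places). Then (E_F/𝔭₁) = (E_F/𝔭₂), i.e. 𝔭₁ is primary if and only if 𝔭₂ is primary. -/
open NumberField
open scoped Classical

/-- The quadratic residue symbol `[α/𝔭] ∈ {±1}`, determined by Euler's congruence
`[α/𝔭] ≡ α^((N𝔭 - 1)/2) (mod 𝔭)`. -/
noncomputable def quadResSym (F : Type*) [Field F] [NumberField F]
    (𝔭 : Ideal (𝓞 F)) (α : 𝓞 F) : ℤ :=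
  if α ^ ((Ideal.absNorm 𝔭 - 1) / 2) - 1 ∈ 𝔭 then 1 else -1

/-- An ideal `𝔭` is primary if `[ε/𝔭] = 1` for every unit `ε`, i.e. `(E_F/𝔭) = +1`. -/
def IsPrimaryIdeal (F : Type*) [Field F] [NumberField F] (𝔭 : Ideal (𝓞 F)) : Prop :=
  ∀ ε : (𝓞 F)ˣ, quadResSym F 𝔭 (ε : 𝓞 F) = 1

lemma pgs_cosKernel_tendsto (a : UnitAddCircle) :
    Filter.Tendsto (HurwitzZeta.cosKernel a) Filter.atTop (nhds 1) := by
  obtain ⟨p, hp, h⟩ := HurwitzZeta.isBigO_atTop_cosKernel_sub a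
  have h1 : Filter.Tendsto (fun x : ℝ => Real.exp (-p * x)) Filter.atTop (nhds 0) := by
    refine Real.tendsto_exp_atBot.comp ?_
    exact Filter.tendsto_id.const_mul_atTop_of_neg (by linarith)
  have h2 := h.trans_tendsto h1
  simpa using h2.add_const 1

lemma pgs_evenKernel_tendsto (M : ℕ) (hM : 0 < M) (a : UnitAddCircle) :
    Filter.Tendsto (fun t : ℝ => Real.sqrt t * HurwitzZeta.evenKernel a (t * M ^ 2))
      (nhdsWithin 0 (Set.Ioi 0)) (nhds (1 / M)) := by
  have hM' : (0 : ℝ) < M := by exact_mod_cast hM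
  have h0 : Filter.Tendsto (fun t : ℝ => 1 / (t * (M : ℝ) ^ 2)) (nhdsWithin 0 (Set.Ioi 0))
      Filter.atTop := by
    have := (tendsto_inv_nhdsGT_zero (𝕜 := ℝ)).atTop_mul_const (r := ((M : ℝ) ^ 2)⁻¹) (by positivity)
    refine this.congr fun t => ?_
    simp [mul_comm]
  have h1 := ((pgs_cosKernel_tendsto a).comp h0).const_mul (1 / (M : ℝ))
  rw [mul_one] at h1
  refine h1.congr' ?_
  filter_upwards [self_mem_nhdsWithin] with t ht
  have ht' : (0 : ℝ) < t := ht
  rw [HurwitzZeta.evenKernel_functional_equation, ← Real.sqrt_eq_rpow,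
    Real.sqrt_mul ht'.le, Real.sqrt_sq hM'.le]
  have : Real.sqrt t ≠ 0 := (Real.sqrt_pos.mpr ht').ne'
  simp only [Function.comp]
  field_simp

lemma pgs_mean (M : ℕ) (hM : 0 < M) (f : ℤ → ℂ) (hf : ∀ n m : ℤ, f (n + M * m) = f n) :
    Filter.Tendsto (fun t : ℝ => (Real.sqrt t : ℂ) *
        ∑' n : ℤ, f n * (Real.exp (-Real.pi * n ^ 2 * t) : ℝ))
      (nhdsWithin 0 (Set.Ioi 0)) (nhds ((1 / M : ℂ) * ∑ x : Fin M, f (x : ℕ))) := by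
  have hM' : (0 : ℝ) < M := by exact_mod_cast hM
  have : NeZero M := ⟨hM.ne'⟩
  have key : ∀ t : ℝ, 0 < t → ∑' n : ℤ, f n * ((Real.exp (-Real.pi * n ^ 2 * t) : ℝ) : ℂ)
      = ∑ x : Fin M, f (x : ℕ) *
        (HurwitzZeta.evenKernel (((x : ℕ) / M : ℝ) : UnitAddCircle) (t * M ^ 2) : ℝ) := by
    intro t ht
    have hx : ∀ x : Fin M, HasSum (fun m : ℤ =>
        f ((Int.divModEquiv M).symm (m, x)) *
          ((Real.exp (-Real.pi * (((Int.divModEquiv M).symm (m, x) : ℤ) : ℝ) ^ 2 * t) : ℝ) : ℂ))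
        (f (x : ℕ) *
        (HurwitzZeta.evenKernel (((x : ℕ) / M : ℝ) : UnitAddCircle) (t * M ^ 2) : ℝ)) := by
      intro x
      have h := HurwitzZeta.hasSum_int_evenKernel ((x : ℕ) / M : ℝ) (t := t * M ^ 2) (by positivity)
      have h2 := (Complex.hasSum_ofReal.mpr h).mul_left (f (x : ℕ))
      refine h2.congr_fun fun m => ?_
      have e : ((Int.divModEquiv M).symm (m, x) : ℤ) = (x : ℕ) + M * m := by
        simp [Int.divModEquiv]; ring
      rw [e, hf]
      congr 3
      push_cast
      field_simp
      ring
    have hZ : Summable (fun n : ℤ => f n * ((Real.exp (-Real.pi * n ^ 2 * t) : ℝ) : ℂ)) := by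
      have h0 := (HurwitzZeta.hasSum_int_evenKernel 0 ht).summable
      refine Summable.of_norm_bounded (h0.mul_left (∑ x : Fin M, ‖f (x : ℕ)‖)) fun n => ?_
      rw [norm_mul]
      have e1 : f n = f ((((Int.divModEquiv M n).2 : Fin M) : ℕ) : ℤ) := by
        conv_lhs => rw [← (Int.divModEquiv M).symm_apply_apply n]
        have e : ((Int.divModEquiv M).symm (Int.divModEquiv M n) : ℤ) =
            (((Int.divModEquiv M n).2 : Fin M) : ℕ) + M * (Int.divModEquiv M n).1 := by
          rw [Int.divModEquiv_symm_apply]; ring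
        rw [e, hf]
      rw [e1]
      gcongr
      · exact Finset.single_le_sum (f := fun x : Fin M => ‖f (x : ℕ)‖)
          (fun _ _ => norm_nonneg _) (Finset.mem_univ _)
      · rw [Complex.norm_real, Real.norm_eq_abs, abs_of_pos (Real.exp_pos _), add_zero]
    rw [← (Int.divModEquiv M).symm.tsum_eq, ← (Equiv.prodComm (Fin M) ℤ).tsum_eq]
    have hs := (Equiv.prodComm (Fin M) ℤ).summable_iff.mpr
      ((Int.divModEquiv M).symm.summable_iff.mpr hZ)
    refine (Summable.tsum_prod' (f := fun p : Fin M × ℤ => f ((Int.divModEquiv M).symm (p.2, p.1)) *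
          ((Real.exp (-Real.pi * (((Int.divModEquiv M).symm (p.2, p.1) : ℤ) : ℝ) ^ 2 * t) : ℝ) : ℂ)) hs
          (fun x => (hx x).summable)).trans ?_
    rw [tsum_fintype]
    exact Finset.sum_congr rfl fun x _ => (hx x).tsum_eq
  have hlim : Filter.Tendsto (fun t : ℝ => ∑ x : Fin M, f (x : ℕ) *
        ((Real.sqrt t * HurwitzZeta.evenKernel (((x : ℕ) / M : ℝ) : UnitAddCircle) (t * M ^ 2) : ℝ) : ℂ))
      (nhdsWithin 0 (Set.Ioi 0)) (nhds (∑ x : Fin M, f (x : ℕ) * ((1 / M : ℝ) : ℂ))) := by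
    refine tendsto_finsetSum _ fun x _ => Filter.Tendsto.const_mul _ ?_
    exact (Complex.continuous_ofReal.tendsto _).comp (pgs_evenKernel_tendsto M hM _)
  have e2 : (1 / M : ℂ) * ∑ x : Fin M, f (x : ℕ) = ∑ x : Fin M, f (x : ℕ) * ((1 / M : ℝ) : ℂ) := by
    rw [Finset.mul_sum]; refine Finset.sum_congr rfl fun x _ => ?_
    push_cast; ring
  rw [e2]
  refine hlim.congr' ?_
  filter_upwards [self_mem_nhdsWithin] with t ht
  rw [key t ht, Finset.mul_sum]
  refine Finset.sum_congr rfl fun x _ => ?_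
  push_cast; ring

lemma pgs_theta_tendsto (l : Filter ℝ) (w : ℝ → ℂ)
    (hw : Filter.Tendsto (fun t => (w t).re) l Filter.atTop) :
    Filter.Tendsto (fun t => ∑' n : ℤ, Complex.exp (-Real.pi * w t * (n : ℂ) ^ 2)) l (nhds 1) := by
  have h1 := (pgs_cosKernel_tendsto 0).comp hw
  have h2 : Filter.Tendsto (fun t => HurwitzZeta.cosKernel 0 (w t).re - 1) l (nhds 0) := by
    simpa using h1.sub_const 1
  rw [tendsto_iff_norm_sub_tendsto_zero]
  refine squeeze_zero' (Filter.Eventually.of_forall fun _ => norm_nonneg _) ?_ h2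
  filter_upwards [hw.eventually_gt_atTop 0] with t ht
  have hE := HurwitzZeta.hasSum_int_evenKernel 0 ht
  have hE0 := hasSum_ite_sub_hasSum hE 0
  have hn : ∀ n : ℤ, ‖Complex.exp (-Real.pi * w t * (n : ℂ) ^ 2)‖ =
      Real.exp (-Real.pi * ((n : ℝ) + 0) ^ 2 * (w t).re) := by
    intro n
    rw [Complex.norm_exp]
    congr 1
    have : (-Real.pi * w t * (n : ℂ) ^ 2) = ((-Real.pi * (n : ℝ) ^ 2 : ℝ) : ℂ) * w t := by
      push_cast; ring
    rw [this, Complex.re_ofReal_mul]; ring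
  have hS : Summable (fun n : ℤ => Complex.exp (-Real.pi * w t * (n : ℂ) ^ 2)) := by
    refine Summable.of_norm ?_
    simp_rw [hn]
    exact hE.summable
  have hS0 := hasSum_ite_sub_hasSum hS.hasSum 0
  have e : (∑' n : ℤ, Complex.exp (-Real.pi * w t * (n : ℂ) ^ 2)) - 1 =
     ∑' n : ℤ, if n = 0 then 0 else Complex.exp (-Real.pi * w t * (n : ℂ) ^ 2) := by
    rw [hS0.tsum_eq]; simp
  rw [e]
  refine tsum_of_norm_bounded (g := fun n : ℤ => if n = 0 then 0 else
    Real.exp (-Real.pi * ((n : ℝ) + 0) ^ 2 * (w t).re)) ?_ ?_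
  · convert! hE0 using 1
    rw [← HurwitzZeta.evenKernel_eq_cosKernel_of_zero]; simp
  · intro n
    split_ifs
    · simp
    · rw [hn]

lemma pgs_cpow_mul (r : ℝ) (hr : 0 < r) (z : ℂ) (hz : z ≠ 0) (s : ℂ) :
    ((r : ℂ) * z) ^ s = (r : ℂ) ^ s * z ^ s := by
  have hr' : (r : ℂ) ≠ 0 := by exact_mod_cast hr.ne'
  rw [Complex.cpow_def_of_ne_zero (mul_ne_zero hr' hz), Complex.cpow_def_of_ne_zero hr',
    Complex.cpow_def_of_ne_zero hz, Complex.log_ofReal_mul hr hz, ← Complex.exp_add,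
    Complex.ofReal_log hr.le]
  congr 1; ring

lemma pgs_cpow_half (r : ℝ) (hr : 0 < r) : (r : ℂ) ^ (-1 / 2 : ℂ) = ((Real.sqrt r)⁻¹ : ℝ) := by
  rw [show (-1 / 2 : ℂ) = ((-(1 / 2) : ℝ) : ℂ) by push_cast; ring, ← Complex.ofReal_cpow hr.le,
    Real.rpow_neg hr.le, Real.sqrt_eq_rpow]

/-- Value of the quadratic Gauss sum of even modulus. -/
lemma pgs_gauss (N : ℕ) (hN : 0 < N) :
    ∑ x : Fin (2 * N), Complex.exp (2 * Real.pi * Complex.I * (((x : ℕ) : ℂ) ^ 2 / (4 * N))) =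
      Real.sqrt (2 * N) * (-Complex.I) ^ (-1 / 2 : ℂ) := by
  have hN' : (0 : ℝ) < N := by exact_mod_cast hN
  have hNc : (N : ℂ) ≠ 0 := by exact_mod_cast hN.ne'
  set f : ℤ → ℂ := fun n => Complex.exp (2 * Real.pi * Complex.I * ((n : ℂ) ^ 2 / (4 * N))) with hf
  have hper : ∀ n m : ℤ, f (n + (2 * N : ℕ) * m) = f n := by
    intro n m
    simp only [hf]
    rw [Complex.exp_eq_exp_iff_exists_int]
    refine ⟨n * m + N * m ^ 2, ?_⟩
    push_cast
    field_simp
    ring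
  have h1 := pgs_mean (2 * N) (by omega) f hper
  set a : ℝ → ℂ := fun t => t - Complex.I / (2 * N) with ha
  set w : ℝ → ℂ := fun t => (1 / (4 * N ^ 2 * t) : ℝ) + Complex.I / (2 * N) with hw
  have are : ∀ t, (a t).re = t := by
    intro t; simp [ha, Complex.div_re]
  have wre : ∀ t, (w t).re = 1 / (4 * N ^ 2 * t) := by
    intro t
    simp only [hw, Complex.add_re, Complex.ofReal_re]
    simp [Complex.div_re]
  have hwt : Filter.Tendsto (fun t => (w t).re) (nhdsWithin 0 (Set.Ioi 0)) Filter.atTop := by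
    simp_rw [wre]
    have := (tendsto_inv_nhdsGT_zero (𝕜 := ℝ)).const_mul_atTop (r := (4 * (N : ℝ) ^ 2)⁻¹) (by positivity)
    refine this.congr fun t => ?_
    simp
    ring
  have h2 := pgs_theta_tendsto _ w hwt
  have hatend : Filter.Tendsto a (nhdsWithin 0 (Set.Ioi 0)) (nhds (a 0)) := by
    have : Continuous a := by simp only [ha]; fun_prop
    exact (this.tendsto 0).mono_left nhdsWithin_le_nhds
  have ha0 : a 0 = ((1 / (2 * N) : ℝ) : ℂ) * (-Complex.I) := by
    simp [ha]; field_simp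
  have hcp : Filter.Tendsto (fun t => (a t) ^ (-1 / 2 : ℂ)) (nhdsWithin 0 (Set.Ioi 0))
      (nhds ((a 0) ^ (-1 / 2 : ℂ))) := by
    refine hatend.cpow tendsto_const_nhds ?_
    rw [ha0, Complex.mem_slitPlane_iff]
    right
    simp [hN.ne']
  have hcq : Filter.Tendsto (fun t => (-(2 * N * Complex.I) / a t) ^ (-1 / 2 : ℂ))
      (nhdsWithin 0 (Set.Ioi 0)) (nhds ((((2 * N) ^ 2 : ℝ) : ℂ) ^ (-1 / 2 : ℂ))) := by
    have hne : a 0 ≠ 0 := by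
      rw [ha0]; simp [hN.ne']
    have e : (((2 * N) ^ 2 : ℝ) : ℂ) = -(2 * N * Complex.I) / a 0 := by
      rw [eq_div_iff hne, ha0]; push_cast; field_simp
    have h := (tendsto_const_nhds (x := -(2 * (N : ℂ) * Complex.I))).div hatend hne
    rw [← e] at h
    refine h.cpow tendsto_const_nhds ?_
    rw [Complex.mem_slitPlane_iff]
    left
    rw [Complex.ofReal_re]; positivity
  have h3 := (hcp.mul hcq).mul h2
  have h4 : ∀ᶠ t in nhdsWithin (0 : ℝ) (Set.Ioi 0),
      (Real.sqrt t : ℂ) * ∑' n : ℤ, f n * (Real.exp (-Real.pi * n ^ 2 * t) : ℝ) =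
      (a t) ^ (-1 / 2 : ℂ) * (-(2 * N * Complex.I) / a t) ^ (-1 / 2 : ℂ) *
        ∑' n : ℤ, Complex.exp (-Real.pi * w t * (n : ℂ) ^ 2) := by
    filter_upwards [self_mem_nhdsWithin] with t ht
    have ht' : (0 : ℝ) < t := ht
    have htc : (t : ℂ) ≠ 0 := by exact_mod_cast ht'.ne'
    have hane : a t ≠ 0 := by
      intro h; have := are t; rw [h] at this; simp at this; linarith
    set z : ℂ := t * (-(2 * N * Complex.I) / a t) with hz
    have hzne : z ≠ 0 := by simp [hz, htc, hane, hN.ne']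
    have hzw : 1 / z = w t := by
      rw [div_eq_iff hzne, hz, hw]
      field_simp
      simp only [ha]
      push_cast
      field_simp
      ring_nf
      simp only [Complex.I_sq]
      ring
    have hza : 1 / a t = 2 * N * Complex.I + z := by
      rw [hz]; field_simp
      simp only [ha]; field_simp; ring_nf; simp only [Complex.I_sq]; ring
    have hzre : 0 < z.re := by
      have : z = (w t)⁻¹ := by rw [← hzw]; simp
      rw [this, Complex.inv_re, wre]
      refine div_pos (by positivity) (Complex.normSq_pos.mpr ?_)
      rw [← hzw]; simp [hzne]
    have s1 : ∑' n : ℤ, f n * (Real.exp (-Real.pi * n ^ 2 * t) : ℝ) =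
        ∑' n : ℤ, Complex.exp (-Real.pi * a t * (n : ℂ) ^ 2) := by
      refine tsum_congr fun n => ?_
      simp only [hf, ha]
      push_cast
      rw [← Complex.exp_add]
      congr 1
      field_simp
      ring
    have s2 : ∑' n : ℤ, Complex.exp (-Real.pi / a t * (n : ℂ) ^ 2) =
        ∑' n : ℤ, Complex.exp (-Real.pi * z * (n : ℂ) ^ 2) := by
      refine tsum_congr fun n => ?_
      rw [Complex.exp_eq_exp_iff_exists_int]
      refine ⟨-(N * n ^ 2), ?_⟩
      have : -Real.pi / a t = -Real.pi * (1 / a t) := by ring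
      rw [this, hza]; push_cast; ring
    have s3 : ∑' n : ℤ, Complex.exp (-Real.pi / z * (n : ℂ) ^ 2) =
        ∑' n : ℤ, Complex.exp (-Real.pi * w t * (n : ℂ) ^ 2) := by
      refine tsum_congr fun n => ?_
      rw [← hzw]; congr 1; ring
    rw [s1, Complex.tsum_exp_neg_mul_int_sq (by rw [are]; exact ht'), s2,
      Complex.tsum_exp_neg_mul_int_sq hzre, s3]
    have c1 : ∀ u : ℂ, 1 / u ^ (1 / 2 : ℂ) = u ^ (-1 / 2 : ℂ) := by
      intro u
      rw [show (-1 / 2 : ℂ) = -(1 / 2) by ring, Complex.cpow_neg]; simp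
    have hq : -(2 * N * Complex.I) / a t ≠ 0 := by simp [hane, hN.ne']
    rw [c1, c1, hz, pgs_cpow_mul t ht' _ hq, pgs_cpow_half t ht']
    have hst : (Real.sqrt t : ℂ) ≠ 0 := by exact_mod_cast (Real.sqrt_pos.mpr ht').ne'
    push_cast
    field_simp
  have h5 := tendsto_nhds_unique (h1.congr' h4) h3
  rw [ha0, pgs_cpow_mul _ (by positivity) _ (by simp), pgs_cpow_half _ (by positivity),
    pgs_cpow_half _ (by positivity), Real.sqrt_sq (by positivity), mul_one, one_div, one_div,
    Real.sqrt_inv, inv_inv] at h5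
  have h6 : ∑ x : Fin (2 * N), f (x : ℕ) = Real.sqrt (2 * N) * (-Complex.I) ^ (-1 / 2 : ℂ) := by
    generalize (-Complex.I) ^ (-1 / 2 : ℂ) = ζ at h5 ⊢
    push_cast at h5
    field_simp at h5
    linear_combination h5
  rw [← h6]
  simp [hf]

lemma pgs_unit : ‖(-Complex.I) ^ (-1 / 2 : ℂ)‖ = 1 := by
  rw [show (-1 / 2 : ℂ) = ((-(1 / 2) : ℝ) : ℂ) by push_cast; ring, Complex.norm_cpow_real]
  simp


noncomputable def pgs_e (r : ℚ) : ℂ := Complex.exp (2 * Real.pi * Complex.I * (r : ℂ))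

lemma pgs_e_add (r s : ℚ) : pgs_e (r + s) = pgs_e r * pgs_e s := by
  unfold pgs_e; rw [← Complex.exp_add]; congr 1; push_cast; ring

lemma pgs_e_int (n : ℤ) : pgs_e n = 1 := by
  unfold pgs_e; rw [Complex.exp_eq_one_iff]; exact ⟨n, by push_cast; ring⟩

lemma pgs_e_eq_one (r : ℚ) : pgs_e r = 1 ↔ ∃ n : ℤ, r = n := by
  constructor
  · intro h
    unfold pgs_e at h
    rw [Complex.exp_eq_one_iff] at h
    obtain ⟨n, hn⟩ := h
    refine ⟨n, ?_⟩
    have h2 : (2 * Real.pi * Complex.I : ℂ) ≠ 0 := Complex.two_pi_I_ne_zero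
    have : (r : ℂ) = n := by
      apply mul_left_cancel₀ h2; rw [hn]; ring
    exact_mod_cast this
  · rintro ⟨n, rfl⟩; exact pgs_e_int n

lemma pgs_e_add_int (r s : ℚ) (h : ∃ n : ℤ, s = n) : pgs_e (r + s) = pgs_e r := by
  rw [pgs_e_add, (pgs_e_eq_one s).mpr h, mul_one]

lemma pgs_e_zero : pgs_e 0 = 1 := by simpa using pgs_e_int 0

lemma pgs_e_neg (r : ℚ) : pgs_e (-r) = (starRingEnd ℂ) (pgs_e r) := by
  unfold pgs_e
  rw [← Complex.exp_conj]
  congr 1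
  simp
  left
  exact (Complex.conj_ofNat 2).symm

lemma pgs_e_sum {ι : Type*} (s : Finset ι) (f : ι → ℚ) :
    pgs_e (∑ i ∈ s, f i) = ∏ i ∈ s, pgs_e (f i) := by
  induction s using Finset.induction_on with
  | empty => simp [pgs_e_zero]
  | insert a s ha ih => rw [Finset.sum_insert ha, Finset.prod_insert ha, pgs_e_add, ih]

section rep
variable {V : Type*} [AddCommGroup V]

def pgs_IsRep {ι : Type*} (A B : AddSubgroup V) (r : ι → V) : Prop :=
  (∀ i, r i ∈ B) ∧ ∀ x ∈ B, ∃! i, x - r i ∈ A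

lemma pgs_rep_sum {ι κ : Type*} [Fintype ι] [Fintype κ] {A B : AddSubgroup V} {r : ι → V} {s : κ → V}
    (hr : pgs_IsRep A B r) (hs : pgs_IsRep A B s) (f : V → ℂ)
    (hf : ∀ x ∈ B, ∀ y ∈ A, f (x + y) = f x) : ∑ i, f (r i) = ∑ j, f (s j) := by
  choose φ hφ hφu using fun i => hs.2 (r i) (hr.1 i)
  refine Fintype.sum_bijective φ ⟨?_, ?_⟩ _ _ ?_
  · intro i j hij
    have h1 := hφ i
    have h2 := hφ j
    rw [← hij] at h2
    have h3 := A.sub_mem h1 h2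
    simp only [sub_sub_sub_cancel_right] at h3
    exact ((hr.2 (r i) (hr.1 i)).unique (by simp [A.zero_mem]) h3)
  · intro j
    obtain ⟨i, hi, -⟩ := hr.2 (s j) (hs.1 j)
    refine ⟨i, (hφu i j ?_).symm⟩
    have := A.neg_mem hi
    simpa using this
  · intro i
    have := hf (s (φ i)) (hs.1 _) _ (hφ i)
    rwa [add_sub_cancel] at this

lemma pgs_rep_sub {ι : Type*} {A B C : AddSubgroup V} {r : ι → V} (hr : pgs_IsRep A C r)
    (hAB : A ≤ B) (hBC : B ≤ C) : pgs_IsRep A B (fun i : {i // r i ∈ B} => r i) := by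
  refine ⟨fun i => i.2, fun x hx => ?_⟩
  obtain ⟨i, hi, hu⟩ := hr.2 x (hBC hx)
  have hiB : r i ∈ B := by
    have := B.sub_mem hx (hAB hi)
    simpa using this
  exact ⟨⟨i, hiB⟩, hi, fun j hj => Subtype.ext (hu _ hj)⟩

lemma pgs_rep_prod {ι κ : Type*} {A B C : AddSubgroup V} {r : ι → V} {s : κ → V}
    (hr : pgs_IsRep A B r) (hs : pgs_IsRep B C s) (hAB : A ≤ B) (hBC : B ≤ C) :
    pgs_IsRep A C (fun p : κ × ι => s p.1 + r p.2) := by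
  refine ⟨fun p => C.add_mem (hs.1 _) (hBC (hr.1 _)), fun x hx => ?_⟩
  obtain ⟨k, hk, hku⟩ := hs.2 x hx
  obtain ⟨i, hi, hiu⟩ := hr.2 _ hk
  refine ⟨(k, i), by simpa [sub_sub] using hi, ?_⟩
  rintro ⟨k', i'⟩ h
  have hk' : k' = k := by
    refine hku k' ?_
    have := B.add_mem (hAB h) (hr.1 i')
    simpa [sub_add_eq_sub_sub] using this
  subst hk'
  have : i' = i := hiu i' (by simpa [sub_sub] using h)
  rw [this]

lemma pgs_rep_translate {ι : Type*} {A B : AddSubgroup V} {r : ι → V}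
    (hr : pgs_IsRep A B r) (h : V) (hh : h ∈ B) : pgs_IsRep A B (fun i => r i + h) := by
  refine ⟨fun i => B.add_mem (hr.1 i) hh, fun x hx => ?_⟩
  obtain ⟨i, hi, hu⟩ := hr.2 _ (B.sub_mem hx hh)
  refine ⟨i, by simpa [sub_sub, add_comm] using hi, fun j hj => hu j ?_⟩
  simpa [sub_sub, add_comm] using hj

end rep

section lat
variable {V : Type*} [AddCommGroup V] [Module ℚ V] {ι : Type*} [Fintype ι]

def pgs_L (e : Module.Basis ι ℚ V) (a : ι → ℤ) : AddSubgroup V where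
  carrier := {x | ∀ i, ∃ n : ℤ, a i * e.repr x i = n}
  zero_mem' := fun i => ⟨0, by simp⟩
  add_mem' := by
    intro x y hx hy i
    obtain ⟨n, hn⟩ := hx i
    obtain ⟨m, hm⟩ := hy i
    exact ⟨n + m, by simp [mul_add, hn, hm]⟩
  neg_mem' := by
    intro x hx i
    obtain ⟨n, hn⟩ := hx i
    exact ⟨-n, by simp [hn]⟩

lemma pgs_mem_L (e : Module.Basis ι ℚ V) (a : ι → ℤ) (x : V) :
    x ∈ pgs_L e a ↔ ∀ i, ∃ n : ℤ, a i * e.repr x i = n := Iff.rfl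

noncomputable def pgs_w (e : Module.Basis ι ℚ V) (a : ι → ℤ) (k : ∀ i, Fin (2 * (a i).natAbs)) : V :=
  ∑ i, (((k i : ℕ) : ℚ) / (2 * a i)) • e i

lemma pgs_w_repr (e : Module.Basis ι ℚ V) (a : ι → ℤ) (k : ∀ i, Fin (2 * (a i).natAbs)) (i : ι) :
    e.repr (pgs_w e a k) i = ((k i : ℕ) : ℚ) / (2 * a i) := by
  unfold pgs_w
  rw [e.repr_sum_self]

lemma pgs_w_rep (e : Module.Basis ι ℚ V) (a : ι → ℤ) (ha : ∀ i, a i ≠ 0) :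
    pgs_IsRep (pgs_L e 1) (pgs_L e (2 * a)) (pgs_w e a) := by
  have haq : ∀ i, (a i : ℚ) ≠ 0 := fun i => by exact_mod_cast ha i
  refine ⟨fun k i => ⟨(k i : ℕ), ?_⟩, fun x hx => ?_⟩
  · rw [pgs_w_repr]; have := haq i; simp; field_simp
  · choose n hn using hx
    have hpos : ∀ i, 0 < 2 * (a i).natAbs := fun i => by
      have := Int.natAbs_pos.mpr (ha i); omega
    have key : ∀ (k : ∀ i, Fin (2 * (a i).natAbs)), x - pgs_w e a k ∈ pgs_L e 1 ↔
        ∀ i, (2 * a i) ∣ n i - (k i : ℕ) := by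
      intro k
      rw [pgs_mem_L]
      refine forall_congr' fun i => ?_
      have h1 := hn i
      have h2 := haq i
      simp only [Pi.mul_apply, Pi.ofNat_apply] at h1
      push_cast at h1
      have hx : e.repr x i = n i / (2 * a i) := by field_simp; linarith
      simp only [map_sub, Finsupp.sub_apply, pgs_w_repr, hx, Pi.one_apply]
      constructor
      · rintro ⟨m, hm⟩
        refine ⟨m, ?_⟩
        field_simp at hm
        push_cast at hm
        have : ((n i - (k i : ℕ) : ℤ) : ℚ) = ((2 * a i * m : ℤ) : ℚ) := by push_cast; linarith
        exact_mod_cast this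
      · rintro ⟨m, hm⟩
        refine ⟨m, ?_⟩
        have : ((n i - (k i : ℕ) : ℤ) : ℚ) = ((2 * a i * m : ℤ) : ℚ) := by rw [hm]
        push_cast at this
        field_simp
        push_cast
        linarith
    have habs : ∀ i, ((2 * (a i).natAbs : ℕ) : ℤ) ∣ 2 * a i ∧ 2 * a i ∣ ((2 * (a i).natAbs : ℕ) : ℤ) := by
      intro i
      rw [Nat.cast_mul]
      exact ⟨mul_dvd_mul_left 2 (Int.natAbs_dvd.mpr dvd_rfl), mul_dvd_mul_left 2 (Int.dvd_natAbs.mpr dvd_rfl)⟩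
    have hN : ∀ i, (0 : ℤ) < ((2 * (a i).natAbs : ℕ) : ℤ) := fun i => by exact_mod_cast hpos i
    refine ⟨fun i => ⟨(n i % ((2 * (a i).natAbs : ℕ) : ℤ)).toNat, ?_⟩, ?_, ?_⟩
    · have := Int.emod_lt_of_pos (n i) (hN i)
      have := Int.emod_nonneg (n i) (hN i).ne'
      omega
    · refine (key _).mpr ?_
      intro i
      refine (habs i).2.trans ?_
      simp only
      rw [Int.toNat_of_nonneg (Int.emod_nonneg (n i) (hN i).ne')]
      exact Int.dvd_self_sub_emod
    · intro k hk
      rw [key] at hk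
      funext i
      have h1 := (habs i).1.trans (hk i)
      apply Fin.ext
      have h2 : n i % ((2 * (a i).natAbs : ℕ) : ℤ) = (k i : ℕ) := by
        rw [Int.emod_eq_emod_iff_emod_sub_eq_zero.mpr (Int.emod_eq_zero_of_dvd h1)]
        exact Int.emod_eq_of_lt (by positivity) (by exact_mod_cast (k i).2)
      simp only [h2]
      simp

lemma pgs_gauss_int (a : ℤ) (ha : a ≠ 0) :
    ∑ x : Fin (2 * a.natAbs), pgs_e (((x : ℕ) : ℚ) ^ 2 / (4 * a)) =
      Real.sqrt (2 * a.natAbs) * (if 0 < a then (-Complex.I) ^ (-1 / 2 : ℂ) else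
        (starRingEnd ℂ) ((-Complex.I) ^ (-1 / 2 : ℂ))) := by
  have h := pgs_gauss a.natAbs (Int.natAbs_pos.mpr ha)
  have h' : ∑ x : Fin (2 * a.natAbs), pgs_e (((x : ℕ) : ℚ) ^ 2 / (4 * a.natAbs)) =
      Real.sqrt (2 * a.natAbs) * (-Complex.I) ^ (-1 / 2 : ℂ) := by
    rw [← h]
    refine Finset.sum_congr rfl fun x _ => ?_
    unfold pgs_e
    push_cast
    rfl
  split_ifs with h0
  · rw [← h']
    refine Finset.sum_congr rfl fun x _ => ?_
    have : ((a.natAbs : ℕ) : ℚ) = a := by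
      rw [Nat.cast_natAbs, abs_of_pos h0]
    rw [this]
  · have e1 : ((a.natAbs : ℕ) : ℚ) = -a := by
      rw [Nat.cast_natAbs, abs_of_nonpos (by omega)]
      push_cast
      rfl
    have h2 := congrArg (starRingEnd ℂ) h'
    rw [map_sum, map_mul, Complex.conj_ofReal] at h2
    rw [← h2]
    refine Finset.sum_congr rfl fun x _ => ?_
    rw [← pgs_e_neg, e1]
    congr 1
    rw [mul_neg, div_neg, neg_neg]

/-- Milgram type positivity for lattices of signature zero. -/
theorem pgs_lattice (b : LinearMap.BilinForm ℚ V) (hs : ∀ x y, b x y = b y x)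
    (L M : AddSubgroup V) (hLq : ∀ x ∈ L, ∃ n : ℤ, b x x / 2 = n)
    (hM : ∀ x, x ∈ M ↔ ∀ y ∈ L, ∃ n : ℤ, b x y = n)
    (e : Module.Basis ι ℚ V) (a : ι → ℤ) (heL : ∀ i, e i ∈ L) (ha : ∀ i, a i ≠ 0)
    (hee : ∀ i j, b (e i) (e j) = if i = j then 2 * (a i : ℚ) else 0)
    (hsig : (Finset.univ.filter (fun i => 0 < a i)).card =
      (Finset.univ.filter (fun i => ¬ 0 < a i)).card)
    {J : Type*} [Fintype J] (g : J → V) (hg : pgs_IsRep L M g) :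
    ∃ r : ℝ, 0 < r ∧ ∑ j, pgs_e (b (g j) (g j) / 2) = r := by
  set L' := pgs_L e 1 with hL'
  set M' := pgs_L e (2 * a) with hM'
  set f : V → ℂ := fun x => pgs_e (b x x / 2) with hf
  have hadd : ∀ x y, b (x + y) (x + y) / 2 = b x x / 2 + (b x y + b y y / 2) := by
    intro x y; simp only [map_add, LinearMap.add_apply]; rw [hs y x]; ring
  have hb : ∀ x j, b x (e j) = 2 * a j * e.repr x j := by
    intro x j
    conv_lhs => rw [← e.sum_repr x]
    rw [map_sum, LinearMap.sum_apply]
    simp only [map_smul, LinearMap.smul_apply, hee, smul_eq_mul, mul_ite, mul_zero]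
    rw [Finset.sum_ite_eq' Finset.univ j]
    simp; ring
  have hq : ∀ x, b x x = ∑ i, 2 * a i * (e.repr x i) ^ 2 := by
    intro x
    conv_lhs => rw [← e.sum_repr x]
    rw [map_sum]
    refine Finset.sum_congr rfl fun i _ => ?_
    rw [map_smul, e.sum_repr, hb, smul_eq_mul]; ring
  have hL'L : L' ≤ L := by
    intro x hx
    rw [← e.sum_repr x]
    refine L.sum_mem fun i _ => ?_
    obtain ⟨n, hn⟩ := hx i
    simp at hn
    rw [hn]
    have := L.zsmul_mem (heL i) n
    rwa [← Int.cast_smul_eq_zsmul ℚ] at this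
  have hMM' : M ≤ M' := by
    intro x hx i
    obtain ⟨n, hn⟩ := (hM x).mp hx _ (heL i)
    refine ⟨n, ?_⟩
    rw [← hn, hb]; simp
  have hLb : ∀ x ∈ L, ∀ y ∈ L, ∃ n : ℤ, b x y = n := by
    intro x hx y hy
    obtain ⟨n1, h1⟩ := hLq _ (L.add_mem hx hy)
    obtain ⟨n2, h2⟩ := hLq _ hx
    obtain ⟨n3, h3⟩ := hLq _ hy
    refine ⟨n1 - n2 - n3, ?_⟩
    have := hadd x y
    rw [h1, h2, h3] at this
    push_cast; linarith
  have hLM : L ≤ M := fun x hx => (hM x).mpr fun y hy => hLb x hx y hy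
  have hM'L' : ∀ x ∈ M', ∀ y ∈ L', ∃ n : ℤ, b x y = n := by
    intro x hx y hy
    choose n hn using hx
    choose m hm using hy
    refine ⟨∑ i, m i * n i, ?_⟩
    conv_lhs => rw [← e.sum_repr y]
    rw [map_sum]
    push_cast
    refine Finset.sum_congr rfl fun i _ => ?_
    rw [map_smul, hb, smul_eq_mul, ← hn, ← hm]; simp
  have hfinv : ∀ x ∈ M', ∀ y ∈ L', f (x + y) = f x := by
    intro x hx y hy
    simp only [hf]
    rw [hadd]
    apply pgs_e_add_int
    obtain ⟨n, hn⟩ := hM'L' x hx y hy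
    obtain ⟨m, hm⟩ := hLq y (hL'L hy)
    exact ⟨n + m, by rw [hn, hm]; push_cast; ring⟩
  have hfinvL : ∀ x ∈ M, ∀ y ∈ L, f (x + y) = f x := by
    intro x hx y hy
    simp only [hf]
    rw [hadd]
    apply pgs_e_add_int
    obtain ⟨n, hn⟩ := (hM x).mp hx y hy
    obtain ⟨m, hm⟩ := hLq y hy
    exact ⟨n + m, by rw [hn, hm]; push_cast; ring⟩
  have hw := pgs_w_rep e a ha
  have hrL := pgs_rep_sub hw hL'L (hLM.trans hMM')
  have hrM := pgs_rep_sub hw (hL'L.trans hLM) hMM'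
  set w := pgs_w e a
  -- inner sums
  have hinner : ∀ x ∈ M', ∑ i : {i // w i ∈ L}, pgs_e (b x (w i)) =
      if x ∈ M then (Fintype.card {i // w i ∈ L} : ℂ) else 0 := by
    intro x hx
    split_ifs with hxM
    · rw [Finset.sum_congr rfl (fun i _ => (pgs_e_eq_one _).mpr ((hM x).mp hxM _ i.2))]
      simp
    · rw [hM] at hxM
      push Not at hxM
      obtain ⟨l, hl, hne⟩ := hxM
      have h1 := pgs_rep_sum hrL (pgs_rep_translate hrL l hl) (fun y => pgs_e (b x y)) (by
        intro y hy z hz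
        simp only [map_add]
        exact pgs_e_add_int _ _ (hM'L' x hx z hz))
      simp only [map_add, pgs_e_add] at h1
      rw [← Finset.sum_mul] at h1
      have h2 : pgs_e (b x l) ≠ 1 := by
        rw [Ne, pgs_e_eq_one]; push Not; exact hne
      by_contra h3
      exact h2 (mul_left_cancel₀ h3 (by rw [mul_one]; exact h1.symm))
  set c : ℂ := (Fintype.card {i // w i ∈ L} : ℂ) with hc
  have hcpos : 0 < Fintype.card {i // w i ∈ L} := by
    obtain ⟨i, -⟩ := hrL.2 0 L.zero_mem
    exact Fintype.card_pos_iff.mpr ⟨i⟩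
  have hc0 : c ≠ 0 := by rw [hc]; exact_mod_cast hcpos.ne'
  have step1 : c * ∑ k, f (w k) = c * ∑ k : {k // w k ∈ M}, f (w k) := by
    calc c * ∑ k, f (w k) = ∑ i : {i // w i ∈ L}, ∑ k, f (w k) := by simp [hc]
      _ = ∑ i : {i // w i ∈ L}, ∑ k, f (w k + w i) := by
          refine Finset.sum_congr rfl fun i _ => ?_
          exact pgs_rep_sum hw (pgs_rep_translate hw (w i) (hMM' (hLM i.2))) f hfinv
      _ = ∑ k, ∑ i : {i // w i ∈ L}, f (w k + w i) := Finset.sum_comm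
      _ = ∑ k, f (w k) * ∑ i : {i // w i ∈ L}, pgs_e (b (w k) (w i)) := by
          refine Finset.sum_congr rfl fun k _ => ?_
          rw [Finset.mul_sum]
          refine Finset.sum_congr rfl fun i _ => ?_
          simp only [hf]
          rw [hadd, ← add_assoc, pgs_e_add_int _ _ (hLq _ i.2), pgs_e_add]
      _ = ∑ k, if w k ∈ M then c * f (w k) else 0 := by
          refine Finset.sum_congr rfl fun k _ => ?_
          rw [hinner _ (hw.1 k)]
          split_ifs <;> ring
      _ = c * ∑ k : {k // w k ∈ M}, f (w k) := by
          rw [← Finset.sum_filter, Finset.mul_sum]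
          exact (Finset.sum_subtype (Finset.univ.filter fun k => w k ∈ M) (by simp)
            (fun k => c * f (w k)))
  have step2 : ∑ k : {k // w k ∈ M}, f (w k) = c * ∑ j, f (g j) := by
    rw [pgs_rep_sum hrM (pgs_rep_prod hrL hg hL'L hLM) f
      (fun x hx y hy => hfinv x (hMM' hx) y hy), Fintype.sum_prod_type, Finset.mul_sum]
    refine Finset.sum_congr rfl fun j _ => ?_
    rw [Finset.sum_congr rfl (fun i _ => hfinvL (g j) (hg.1 j) _ i.2)]
    simp [hc]
  have step3 : ∑ k, f (w k) = ∏ i, ∑ x : Fin (2 * (a i).natAbs), pgs_e (((x : ℕ) : ℚ) ^ 2 / (4 * a i)) := by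
    rw [Finset.prod_univ_sum, Fintype.piFinset_univ]
    refine Finset.sum_congr rfl fun k _ => ?_
    simp only [hf]
    rw [← pgs_e_sum, hq, Finset.sum_div]
    congr 1
    refine Finset.sum_congr rfl fun i _ => ?_
    rw [pgs_w_repr]
    have : (a i : ℚ) ≠ 0 := by exact_mod_cast ha i
    field_simp
    ring
  have step4 : ∃ r : ℝ, 0 < r ∧ ∑ k, f (w k) = r := by
    refine ⟨∏ i, Real.sqrt (2 * (a i).natAbs), Finset.prod_pos fun i _ => ?_, ?_⟩
    · have := Int.natAbs_pos.mpr (ha i)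
      have : (0 : ℝ) < (a i).natAbs := by exact_mod_cast this
      positivity
    · rw [step3, Finset.prod_congr rfl (fun i _ => pgs_gauss_int (a i) (ha i)),
        Finset.prod_mul_distrib, Finset.prod_ite, Finset.prod_const, Finset.prod_const, hsig,
        ← mul_pow, Complex.mul_conj, Complex.normSq_eq_norm_sq, pgs_unit]
      push_cast
      simp
  obtain ⟨r, hr, hr2⟩ := step4
  have h5 := mul_left_cancel₀ hc0 step1
  refine ⟨r / Fintype.card {i // w i ∈ L}, by positivity, ?_⟩
  rw [hr2, step2] at h5
  push_cast
  rw [h5]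
  rw [mul_div_cancel_left₀ _ hc0]

end lat


set_option linter.unusedSectionVars false
set_option linter.style.haveILetI false

section pgsC
variable {F : Type*} [Field F] [NumberField F] {k : Type*} [Field k] [NumberField k] [Algebra F k]

lemma pgs_exists_sigma (hdeg : Module.finrank F k = 2) :
    ∃ σ : k ≃ₐ[F] k, (∀ x, σ (σ x) = x) ∧
      (∀ x, algebraMap F k (Algebra.trace F k x) = x + σ x) ∧
      (∀ x, algebraMap F k (Algebra.norm F x) = x * σ x) := by
  haveI : Module.Finite F k := Module.finite_of_finrank_eq_succ hdeg
  haveI : Algebra.IsQuadraticExtension F k := ⟨hdeg⟩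
  haveI : IsGalois F k := ⟨⟩
  have hcard : Fintype.card (k ≃ₐ[F] k) = 2 := by
    rw [← Nat.card_eq_fintype_card, IsGalois.card_aut_eq_finrank, hdeg]
  obtain ⟨σ, hσ⟩ : ∃ σ : k ≃ₐ[F] k, σ ≠ 1 :=
    Fintype.exists_ne_of_one_lt_card (by omega) 1
  have huniv : (Finset.univ : Finset (k ≃ₐ[F] k)) = {1, σ} := by
    symm
    apply Finset.eq_univ_of_card
    rw [Finset.card_pair hσ.symm, hcard]
  refine ⟨σ, ?_, ?_, ?_⟩
  · intro x
    have h1 : σ * σ ∈ (Finset.univ : Finset (k ≃ₐ[F] k)) := Finset.mem_univ _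
    rw [huniv, Finset.mem_insert, Finset.mem_singleton] at h1
    rcases h1 with h1 | h1
    · exact DFunLike.congr_fun h1 x
    · exact absurd (mul_eq_left.mp h1) hσ
  · intro x
    rw [trace_eq_sum_automorphisms, huniv, Finset.sum_pair hσ.symm]
    rfl
  · intro x
    rw [Algebra.norm_eq_prod_automorphisms, huniv, Finset.prod_pair hσ.symm]
    rfl

/-- the trace form -/
noncomputable def pgs_b (σ : k ≃ₐ[F] k) (c : F) : LinearMap.BilinForm ℚ k :=
  LinearMap.mk₂ ℚ (fun x y => Algebra.trace ℚ k (algebraMap F k c * (x * σ y)))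
    (fun x y z => by rw [add_mul, mul_add, map_add])
    (fun r x y => by rw [smul_mul_assoc, mul_smul_comm, map_smul])
    (fun x y z => by rw [map_add, mul_add, mul_add, map_add])
    (fun r x y => by rw [map_rat_smul, mul_smul_comm, mul_smul_comm, map_smul])

lemma pgs_b_apply (σ : k ≃ₐ[F] k) (c : F) (x y : k) :
    pgs_b σ c x y = Algebra.trace ℚ k (algebraMap F k c * (x * σ y)) := rfl

lemma pgs_trace_smul (c : F) (x : k) :
    Algebra.trace ℚ k (algebraMap F k c * x) = Algebra.trace ℚ F (c * Algebra.trace F k x) := by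
  rw [← Algebra.trace_trace (S := F), ← Algebra.smul_def, map_smul, smul_eq_mul]

lemma pgs_b_symm (σ : k ≃ₐ[F] k) (hσ : ∀ x, σ (σ x) = x)
    (htr : ∀ x, algebraMap F k (Algebra.trace F k x) = x + σ x) (c : F) (x y : k) :
    pgs_b σ c x y = pgs_b σ c y x := by
  rw [pgs_b_apply, pgs_b_apply, pgs_trace_smul, pgs_trace_smul]
  congr 2
  apply (algebraMap F k).injective
  rw [htr, htr, map_mul, map_mul, hσ, hσ]
  ring

lemma pgs_b_self (σ : k ≃ₐ[F] k) (hσ : ∀ x, σ (σ x) = x)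
    (htr : ∀ x, algebraMap F k (Algebra.trace F k x) = x + σ x)
    (hN : ∀ x, algebraMap F k (Algebra.norm F x) = x * σ x) (c : F) (x : k) :
    pgs_b σ c x x / 2 = Algebra.trace ℚ F (c * Algebra.norm F x) := by
  rw [pgs_b_apply, pgs_trace_smul]
  have : Algebra.trace F k (x * σ x) = 2 * Algebra.norm F x := by
    apply (algebraMap F k).injective
    rw [htr, map_mul, map_mul, hN, hσ, map_ofNat]
    ring
  rw [this, mul_left_comm, ← map_ofNat (algebraMap ℚ F), ← Algebra.smul_def, map_smul, smul_eq_mul]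
  ring

lemma pgs_b_nondeg (σ : k ≃ₐ[F] k) (c : F) (hc : c ≠ 0) (x : k)
    (h : ∀ y, pgs_b σ c x y = 0) : x = 0 := by
  by_contra hx
  have h1 : algebraMap F k c * x ≠ 0 :=
    mul_ne_zero ((map_ne_zero (algebraMap F k)).mpr hc) hx
  have h2 := h (σ.symm (algebraMap F k c * x)⁻¹)
  rw [pgs_b_apply, σ.apply_symm_apply, ← mul_assoc, mul_inv_cancel₀ h1] at h2
  rw [← map_one (algebraMap ℚ k), Algebra.trace_algebraMap] at h2
  simp at h2
  exact absurd h2 Module.finrank_pos.ne'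

lemma pgs_b_emb (σ : k ≃ₐ[F] k) (hσ : ∀ x, σ (σ x) = x)
    (htr : ∀ x, algebraMap F k (Algebra.trace F k x) = x + σ x)
    (ψ : (F →ₐ[ℚ] ℂ) → (k →+* ℂ)) (hψ : ∀ φ x, ψ φ (algebraMap F k x) = φ x) (c : F) (x y : k) :
    ((pgs_b σ c x y : ℚ) : ℂ) = ∑ φ : F →ₐ[ℚ] ℂ,
      φ c * (ψ φ x * ψ φ (σ y) + ψ φ y * ψ φ (σ x)) := by
  rw [pgs_b_apply, pgs_trace_smul]
  have := trace_eq_sum_embeddings (K := ℚ) (L := F) ℂ (x := c * Algebra.trace F k (x * σ y))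
  rw [eq_ratCast] at this
  rw [this]
  refine Finset.sum_congr rfl fun φ _ => ?_
  rw [map_mul, ← hψ φ (Algebra.trace F k _), htr]
  simp only [map_mul, map_add, hσ]
  ring

/-- Kernel vector: more than `[F:ℚ]` vectors have a real relation under all embeddings. -/
lemma pgs_kernel (hinf : ∀ φ : F →+* ℝ, ∃ ψ : k →+* ℝ, ψ.comp (algebraMap F k) = φ)
    {ι : Type*} [Fintype ι] (e : ι → k) (hcard : Module.finrank ℚ F < Fintype.card ι) :
    ∃ y : ι → ℝ, y ≠ 0 ∧ ∀ φ : F →ₐ[ℚ] ℂ, ∃ ψ : k →+* ℂ,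
      (∀ x, ψ (algebraMap F k x) = φ x) ∧ ∑ i, (y i : ℂ) * ψ (e i) = 0 := by
  haveI : Algebra.IsAlgebraic F k := Algebra.IsAlgebraic.tower_top (K := ℚ) F
  have hreal : ∀ w : {w : InfinitePlace F // w.IsReal}, ∃ ψ : k →+* ℝ,
      ∀ x, ψ (algebraMap F k x) = InfinitePlace.embedding_of_isReal w.2 x := fun w => by
    obtain ⟨ψ, hψ⟩ := hinf (InfinitePlace.embedding_of_isReal w.2)
    exact ⟨ψ, fun x => DFunLike.congr_fun hψ x⟩
  have hcplx : ∀ w : InfinitePlace F, ∃ ψ : k →+* ℂ,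
      ∀ x, ψ (algebraMap F k x) = w.embedding x := fun w => by
    letI : Algebra F ℂ := w.embedding.toAlgebra
    obtain ⟨f⟩ : Nonempty (k →ₐ[F] ℂ) := ⟨IsAlgClosed.lift⟩
    exact ⟨f.toRingHom, fun x => f.commutes x⟩
  choose ψr hψr using hreal
  choose ψc hψc using hcplx
  let v : ι → mixedEmbedding.mixedSpace F := fun i =>
    (fun w => ψr w (e i), fun w => ψc w.1 (e i))
  have hnot : ¬ LinearIndependent ℝ v := by
    intro h
    have := h.fintype_card_le_finrank
    rw [mixedEmbedding.finrank] at this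
    omega
  rw [Fintype.linearIndependent_iff] at hnot
  push Not at hnot
  obtain ⟨y, hy, i, hi⟩ := hnot
  refine ⟨y, fun h => hi (by rw [h]; rfl), ?_⟩
  have h1 : ∀ w : {w : InfinitePlace F // w.IsReal}, ∑ i, y i * ψr w (e i) = 0 := fun w => by
    have := congrFun (congrArg Prod.fst hy) w
    simpa [v, Prod.fst_sum, Finset.sum_apply] using this
  have h2 : ∀ w : {w : InfinitePlace F // w.IsComplex}, ∑ i, (y i : ℂ) * ψc w.1 (e i) = 0 := fun w => by
    have := congrFun (congrArg Prod.snd hy) w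
    simpa [v, Prod.snd_sum, Finset.sum_apply] using this
  have h3 : ∀ w : InfinitePlace F, ∃ ψ : k →+* ℂ,
      (∀ x, ψ (algebraMap F k x) = w.embedding x) ∧ ∑ i, (y i : ℂ) * ψ (e i) = 0 := by
    intro w
    by_cases hw : w.IsReal
    · refine ⟨Complex.ofRealHom.comp (ψr ⟨w, hw⟩), ?_, ?_⟩
      · intro x
        simp only [RingHom.comp_apply, hψr]
        exact InfinitePlace.embedding_of_isReal_apply hw x
      · have := congrArg (fun r : ℝ => (r : ℂ)) (h1 ⟨w, hw⟩)
        simpa using this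
    · exact ⟨ψc w, hψc w, h2 ⟨w, InfinitePlace.not_isReal_iff_isComplex.mp hw⟩⟩
  intro φ
  obtain ⟨ψ, ha, hb⟩ := h3 (InfinitePlace.mk φ.toRingHom)
  rcases InfinitePlace.embedding_mk_eq φ.toRingHom with h | h
  · exact ⟨ψ, fun x => by rw [ha, h]; rfl, hb⟩
  · refine ⟨(starRingEnd ℂ).comp ψ, fun x => ?_, ?_⟩
    · rw [RingHom.comp_apply, ha, h]
      simp
    · have := congrArg (starRingEnd ℂ) hb
      simpa using this

lemma pgs_sig_aux (hinf : ∀ φ : F →+* ℝ, ∃ ψ : k →+* ℝ, ψ.comp (algebraMap F k) = φ)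
    (σ : k ≃ₐ[F] k) (hσ : ∀ x, σ (σ x) = x)
    (htr : ∀ x, algebraMap F k (Algebra.trace F k x) = x + σ x) (c : F)
    {ι : Type*} [Fintype ι] (e : ι → k) (a : ι → ℚ)
    (h : ∀ i j, pgs_b σ c (e i) (e j) = if i = j then a i else 0) (ha : ∀ i, 0 < a i) :
    Fintype.card ι ≤ Module.finrank ℚ F := by
  by_contra! hlt
  obtain ⟨y, hy, hker⟩ := pgs_kernel hinf e hlt
  choose ψ hψ hz using hker
  have h0 : ∑ i, ∑ j, (y i : ℂ) * (y j : ℂ) * ((pgs_b σ c (e i) (e j) : ℚ) : ℂ) = 0 := by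
    have : ∀ i j, (y i : ℂ) * (y j : ℂ) * ((pgs_b σ c (e i) (e j) : ℚ) : ℂ) =
        ∑ φ : F →ₐ[ℚ] ℂ, (φ c * (((y i : ℂ) * ψ φ (e i)) * ((y j : ℂ) * ψ φ (σ (e j)))) +
          φ c * (((y i : ℂ) * ψ φ (σ (e i))) * ((y j : ℂ) * ψ φ (e j)))) := by
      intro i j
      rw [pgs_b_emb σ hσ htr ψ hψ, Finset.mul_sum]
      refine Finset.sum_congr rfl fun φ _ => ?_
      ring
    simp only [this]
    have h5 : ∀ i, ∑ j, ∑ φ : F →ₐ[ℚ] ℂ, (φ c * (((y i : ℂ) * ψ φ (e i)) * ((y j : ℂ) * ψ φ (σ (e j)))) +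
          φ c * (((y i : ℂ) * ψ φ (σ (e i))) * ((y j : ℂ) * ψ φ (e j)))) =
        ∑ φ : F →ₐ[ℚ] ℂ, φ c * ((y i : ℂ) * ψ φ (e i)) * ∑ j, ((y j : ℂ) * ψ φ (σ (e j))) := by
      intro i
      rw [Finset.sum_comm]
      refine Finset.sum_congr rfl fun φ _ => ?_
      rw [Finset.sum_add_distrib, ← Finset.mul_sum, ← Finset.mul_sum, ← Finset.mul_sum,
        ← Finset.mul_sum, hz φ]
      ring
    simp only [h5]
    rw [Finset.sum_comm]
    refine Finset.sum_eq_zero fun φ _ => ?_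
    rw [← Finset.sum_mul, ← Finset.mul_sum, hz φ]
    ring
  have h1 : ∑ i, (y i : ℝ) ^ 2 * (a i : ℝ) = 0 := by
    have : ((∑ i, (y i : ℝ) ^ 2 * (a i : ℝ) : ℝ) : ℂ) = 0 := by
      rw [← h0]
      push_cast
      refine Finset.sum_congr rfl fun i _ => ?_
      rw [Finset.sum_eq_single i]
      · rw [h, if_pos rfl]; ring
      · intro j _ hj
        rw [h, if_neg hj.symm]; simp
      · simp
    exact_mod_cast this
  rw [Finset.sum_eq_zero_iff_of_nonneg
    (fun i _ => mul_nonneg (sq_nonneg _) (by exact_mod_cast (ha i).le))] at h1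
  apply hy
  funext i
  have := h1 i (Finset.mem_univ _)
  have ha' : (a i : ℝ) ≠ 0 := by exact_mod_cast (ha i).ne'
  simpa [ha'] using this


lemma pgs_G_pos (hdeg : Module.finrank F k = 2)
    (hinf : ∀ φ : F →+* ℝ, ∃ ψ : k →+* ℝ, ψ.comp (algebraMap F k) = φ)
    (σ : k ≃ₐ[F] k) (hσ : ∀ x, σ (σ x) = x)
    (htr : ∀ x, algebraMap F k (Algebra.trace F k x) = x + σ x) (c : F) (hc : c ≠ 0)
    (L M : AddSubgroup k) (hL : ∀ x : k, ∃ n : ℤ, n ≠ 0 ∧ (n : ℚ) • x ∈ L)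
    (hLq : ∀ x ∈ L, ∃ n : ℤ, pgs_b σ c x x / 2 = n)
    (hM : ∀ x, x ∈ M ↔ ∀ y ∈ L, ∃ n : ℤ, pgs_b σ c x y = n)
    {J : Type*} [Fintype J] (g : J → k) (hg : pgs_IsRep L M g) :
    ∃ r : ℝ, 0 < r ∧ ∑ j, pgs_e (pgs_b σ c (g j) (g j) / 2) = r := by
  have hsymm : ∀ x y, pgs_b σ c x y = pgs_b σ c y x := pgs_b_symm σ hσ htr c
  obtain ⟨v, hv⟩ := LinearMap.BilinForm.exists_orthogonal_basis
    (B := pgs_b σ c) ⟨fun x y => hsymm x y⟩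
  choose n hn0 hnL using fun i => hL (v i)
  have hnq : ∀ i, IsUnit ((n i : ℤ) : ℚ) := fun i => by
    have := hn0 i
    exact isUnit_iff_ne_zero.mpr (by exact_mod_cast this)
  let e := v.isUnitSMul hnq
  have heL : ∀ i, e i ∈ L := fun i => by
    have : e i = (n i : ℚ) • v i := v.isUnitSMul_apply hnq i
    rw [this]; exact hnL i
  choose a ha using fun i => hLq (e i) (heL i)
  have hee : ∀ i j, pgs_b σ c (e i) (e j) = if i = j then 2 * (a i : ℚ) else 0 := by
    intro i j
    split_ifs with hij
    · subst hij
      rw [← ha]; ring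
    · have h1 : e i = (n i : ℚ) • v i := v.isUnitSMul_apply hnq i
      have h2 : e j = (n j : ℚ) • v j := v.isUnitSMul_apply hnq j
      have h3 : pgs_b σ c (v i) (v j) = 0 := hv hij
      rw [h1, h2, map_smul, map_smul, LinearMap.smul_apply, h3]
      simp
  have ha0 : ∀ i, a i ≠ 0 := by
    intro i h0
    apply e.ne_zero i
    apply pgs_b_nondeg σ c hc
    intro y
    have : pgs_b σ c (e i) = 0 := by
      apply e.ext
      intro j
      rw [hee]
      simp [h0]
    rw [this]; rfl
  have hsub : ∀ (P : Fin (Module.finrank ℚ k) → Prop) (c' : F) (s : ℚ)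
      (_ : ∀ x y, pgs_b σ c' x y = s * pgs_b σ c x y) (_ : ∀ i, P i → 0 < s * a i),
      (Finset.univ.filter P).card ≤ Module.finrank ℚ F := by
    intro P c' s hs hP
    rw [← Fintype.card_subtype]
    refine pgs_sig_aux hinf σ hσ htr c' (fun i : {i // P i} => e i.1) (fun i => s * (2 * a i.1)) ?_ ?_
    · intro i j
      rw [hs, hee]
      simp [Subtype.ext_iff]
    · intro i
      have := hP i.1 i.2
      linarith
  have hp := hsub (fun i => 0 < a i) c 1 (fun x y => by rw [one_mul]) (fun i hi => by
    rw [one_mul]; exact_mod_cast hi)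
  have hq := hsub (fun i => ¬ 0 < a i) (-c) (-1) (fun x y => by
    simp only [pgs_b_apply, map_neg, neg_mul, one_mul]) (fun i hi => by
    have h1 := ha0 i
    have h2 : (0 : ℤ) < - a i := by omega
    have h3 : (0 : ℚ) < - a i := by exact_mod_cast h2
    linarith)
  have htot := Finset.card_filter_add_card_filter_not (s := Finset.univ) (fun i => 0 < a i)
  rw [Finset.card_univ, Fintype.card_fin] at htot
  have hfr := Module.finrank_mul_finrank ℚ F k
  rw [hdeg] at hfr
  have hpq : (Finset.univ.filter (fun i => 0 < a i)).card =
      (Finset.univ.filter (fun i => ¬ 0 < a i)).card := by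
    have hp2 : (Finset.univ.filter (fun i => 0 < a i)).card ≤ Module.finrank ℚ F := by
      convert hp
    have hq2 : (Finset.univ.filter (fun i => ¬ 0 < a i)).card ≤ Module.finrank ℚ F := by
      convert hq
    have htot2 : (Finset.univ.filter (fun i => 0 < a i)).card +
      (Finset.univ.filter (fun i => ¬ 0 < a i)).card = Module.finrank ℚ k := by
      convert htot
    omega
  exact pgs_lattice (pgs_b σ c) hsymm L M hLq hM e a heL ha0 (by convert hee) (by convert hpq) g hg

end pgsC

set_option linter.unusedSectionVars false
set_option linter.style.haveILetI false

section pgsD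
variable {F : Type*} [Field F] [NumberField F] {k : Type*} [Field k] [NumberField k] [Algebra F k]

lemma pgs_ram (hdeg : Module.finrank F k = 2) (p : Ideal (𝓞 F)) (hp : p.IsPrime) (hp0 : p ≠ ⊥)
    (h : IsRamifiedIn F k p) :
    ∃ P : Ideal (𝓞 k), P.IsPrime ∧ P ≠ ⊥ ∧ P ^ 2 = Ideal.map (algebraMap (𝓞 F) (𝓞 k)) p ∧
      (∀ s : 𝓞 F, algebraMap (𝓞 F) (𝓞 k) s ∈ P ↔ s ∈ p) ∧
      ∀ t : 𝓞 k, ∃ s : 𝓞 F, t - algebraMap (𝓞 F) (𝓞 k) s ∈ P := by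
  obtain ⟨P, hP, J, hJ⟩ := h
  have hmax : p.IsMaximal := hp.isMaximal hp0
  have hmap0 : Ideal.map (algebraMap (𝓞 F) (𝓞 k)) p ≠ ⊥ := by
    rw [Ne, Ideal.map_eq_bot_iff_of_injective (FaithfulSMul.algebraMap_injective (𝓞 F) (𝓞 k))]
    exact hp0
  have hP0 : P ≠ ⊥ := by
    rintro rfl
    apply hmap0
    rw [hJ]; simp
  have hle : p ≤ P.comap (algebraMap (𝓞 F) (𝓞 k)) := by
    rw [← Ideal.map_le_iff_le_comap, hJ]
    exact Ideal.mul_le_left.trans (Ideal.pow_le_self two_ne_zero)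
  have hcomap : P.comap (algebraMap (𝓞 F) (𝓞 k)) = p :=
    (hmax.eq_of_le (Ideal.comap_ne_top _ hP.ne_top) hle).symm
  have hmem : ∀ s : 𝓞 F, algebraMap (𝓞 F) (𝓞 k) s ∈ P ↔ s ∈ p := fun s => by
    rw [← Ideal.mem_comap, hcomap]
  let f : (𝓞 F ⧸ p) →+* (𝓞 k ⧸ P) := Ideal.quotientMap P (algebraMap (𝓞 F) (𝓞 k)) hle
  have hf : Function.Injective f := Ideal.quotientMap_injective' hcomap.le
  haveI : Finite (𝓞 k ⧸ P) := Ideal.finiteQuotientOfFreeOfNeBot P hP0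
  haveI : Finite (𝓞 F ⧸ p) := Ideal.finiteQuotientOfFreeOfNeBot p hp0
  have hcard : Ideal.absNorm p ≤ Ideal.absNorm P := by
    simpa [Ideal.absNorm_apply, Submodule.cardQuot_apply] using Nat.card_le_card_of_injective f hf
  have hn := congrArg Ideal.absNorm hJ
  rw [Ideal.absNorm_algebraMap, map_mul, map_pow] at hn
  have hfr : Module.finrank (𝓞 F) (𝓞 k) = 2 := by
    rw [← hdeg, IsFractionRing.finrank_eq (𝓞 F) F (𝓞 k) k]
  rw [hfr] at hn
  have hpos : 0 < Ideal.absNorm p := Nat.pos_of_ne_zero (by rwa [Ne, Ideal.absNorm_eq_zero_iff])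
  have hJ0 : 0 < Ideal.absNorm J := by
    rcases Nat.eq_zero_or_pos (Ideal.absNorm J) with h0 | h0
    · rw [h0, mul_zero] at hn
      exact absurd hn (by positivity)
    · exact h0
  have h1 : Ideal.absNorm p = Ideal.absNorm P := by nlinarith
  have h2 : Ideal.absNorm J = 1 := by
    rw [h1] at hn hpos
    have : 0 < Ideal.absNorm P ^ 2 := by positivity
    nlinarith
  rw [Ideal.absNorm_eq_one_iff] at h2
  refine ⟨P, hP, hP0, ?_, hmem, ?_⟩
  · rw [hJ, h2, Ideal.mul_top]
  · intro t
    have hbij : Function.Bijective f := by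
      rw [Nat.bijective_iff_injective_and_card]
      refine ⟨hf, ?_⟩
      simpa [Ideal.absNorm_apply, Submodule.cardQuot_apply] using h1
    obtain ⟨s, hs⟩ := hbij.2 (Ideal.Quotient.mk P t)
    obtain ⟨s, rfl⟩ := Ideal.Quotient.mk_surjective s
    refine ⟨s, ?_⟩
    rw [← Ideal.Quotient.eq, ← hs]
    rfl

lemma pgs_diff (hdeg : Module.finrank F k = 2) (p₁ p₂ : Ideal (𝓞 F)) (hp1 : p₁.IsPrime)
    (hp2 : p₂.IsPrime) (hp10 : p₁ ≠ ⊥) (hp20 : p₂ ≠ ⊥)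
    (h21 : (2 : 𝓞 F) ∉ p₁) (h22 : (2 : 𝓞 F) ∉ p₂)
    (hram : ∀ 𝔭 : Ideal (𝓞 F), 𝔭.IsPrime → 𝔭 ≠ ⊥ → (IsRamifiedIn F k 𝔭 → 𝔭 = p₁ ∨ 𝔭 = p₂))
    (P₁ P₂ : Ideal (𝓞 k)) (hP1 : P₁.IsPrime) (hP2 : P₂.IsPrime) (hP10 : P₁ ≠ ⊥) (hP20 : P₂ ≠ ⊥)
    (hP1p : P₁ ^ 2 = Ideal.map (algebraMap (𝓞 F) (𝓞 k)) p₁)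
    (hP2p : P₂ ^ 2 = Ideal.map (algebraMap (𝓞 F) (𝓞 k)) p₂) (hPne : P₁ ≠ P₂) :
    differentIdeal (𝓞 F) (𝓞 k) = P₁ * P₂ := by
  have htr1 : Algebra.intTrace (𝓞 F) (𝓞 k) 1 = 2 := by
    apply FaithfulSMul.algebraMap_injective (𝓞 F) F
    rw [Algebra.algebraMap_intTrace (K := F) (L := k), map_one, ← map_one (algebraMap F k),
      Algebra.trace_algebraMap, hdeg, map_ofNat]
    simp
  have hnd : ∀ (p : Ideal (𝓞 F)) (P : Ideal (𝓞 k)), (2 : 𝓞 F) ∉ p →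
      P ^ 2 = Ideal.map (algebraMap (𝓞 F) (𝓞 k)) p → ¬ P ^ 2 ∣ differentIdeal (𝓞 F) (𝓞 k) := by
    intro p P h2 hP
    refine not_dvd_differentIdeal_of_intTrace_not_mem (𝓞 F) (p := p) (P ^ 2) ⊤ ?_ 1 trivial ?_
    · rw [Ideal.mul_top, hP]
    · rwa [htr1]
  have hd : ∀ (p : Ideal (𝓞 F)) (P : Ideal (𝓞 k)), p.IsPrime → p ≠ ⊥ →
      P ^ 2 = Ideal.map (algebraMap (𝓞 F) (𝓞 k)) p → P ∣ differentIdeal (𝓞 F) (𝓞 k) := by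
    intro p P hp hp0 hP
    haveI := hp.isMaximal hp0
    simpa using pow_sub_one_dvd_differentIdeal (𝓞 F) (p := p) P 2 hp0 hP.dvd
  have hpr1 := Ideal.prime_of_isPrime hP10 hP1
  have hpr2 := Ideal.prime_of_isPrime hP20 hP2
  obtain ⟨E, hE⟩ : P₁ * P₂ ∣ differentIdeal (𝓞 F) (𝓞 k) := by
    obtain ⟨E, hE⟩ := hd p₁ P₁ hp1 hp10 hP1p
    have h2 := hd p₂ P₂ hp2 hp20 hP2p
    rw [hE] at h2 ⊢
    rcases hpr2.dvd_or_dvd h2 with h | h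
    · exact absurd ((Prime.dvd_prime_iff_associated hpr2 hpr1).mp h)
        (by rw [associated_iff_eq]; exact hPne.symm)
    · exact mul_dvd_mul_left _ h
  have hE0 : differentIdeal (𝓞 F) (𝓞 k) ≠ ⊥ := differentIdeal_ne_bot
  have hunit : IsUnit E := by
    by_contra hE1
    have hEne : E ≠ 0 := by
      rintro rfl
      apply hE0; rw [hE]; simp
    obtain ⟨Q, hQirr, hQE⟩ := WfDvdMonoid.exists_irreducible_factor hE1 hEne
    have hQ : Prime Q := hQirr.prime
    have hQp : Q.IsPrime := Ideal.isPrime_of_prime hQ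
    have hQ0 : Q ≠ ⊥ := hQ.ne_zero
    haveI hQmax : Q.IsMaximal := hQp.isMaximal hQ0
    let q := Q.comap (algebraMap (𝓞 F) (𝓞 k))
    have hq : q.IsPrime := Ideal.comap_isPrime _ _
    have hq0 : q ≠ ⊥ := by
      exact Ideal.IsIntegral.comap_ne_bot (𝓞 F) hQ0
    haveI hqmax : q.IsMaximal := hq.isMaximal hq0
    haveI : Finite (𝓞 F ⧸ q) := Ideal.finiteQuotientOfFreeOfNeBot q hq0
    have hQq : Q ∣ Ideal.map (algebraMap (𝓞 F) (𝓞 k)) q :=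
      Ideal.dvd_iff_le.mpr Ideal.map_comap_le
    have hramq : IsRamifiedIn F k q := by
      refine ⟨Q, hQp, ?_⟩
      obtain ⟨J, hJ⟩ := hQq
      by_contra hnot
      have hcop : IsCoprime Q J := by
        rw [Ideal.isCoprime_iff_sup_eq]
        by_contra htop
        have h1 := hQmax.eq_of_le htop le_sup_left
        have h2 : J ≤ Q := le_sup_right.trans h1.ge
        apply hnot
        rw [hJ, pow_two]
        exact mul_dvd_mul_left _ (Ideal.dvd_iff_le.mpr h2)
      exact not_dvd_differentIdeal_of_isCoprime (𝓞 F) (p := q) Q J hcop hJ.symm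
        (hE ▸ hQE.mul_left _)
    have hfin : ∀ (p : Ideal (𝓞 F)) (P : Ideal (𝓞 k)), Prime P → 
        P ^ 2 = Ideal.map (algebraMap (𝓞 F) (𝓞 k)) p → q = p → Q = P := by
      intro p P hP hPp hqp
      rw [hqp, ← hPp] at hQq
      exact associated_iff_eq.mp ((Prime.dvd_prime_iff_associated hQ hP).mp (hQ.dvd_of_dvd_pow hQq))
    rcases hram q hq hq0 hramq with h | h
    · have := hfin p₁ P₁ hpr1 hP1p h
      subst this
      refine hnd p₁ Q h21 hP1p ?_
      rw [hE, pow_two]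
      obtain ⟨E', rfl⟩ := hQE
      exact ⟨P₂ * E', by ring⟩
    · have := hfin p₂ P₂ hpr2 hP2p h
      subst this
      refine hnd p₂ Q h22 hP2p ?_
      rw [hE, pow_two]
      obtain ⟨E', rfl⟩ := hQE
      exact ⟨P₁ * E', by ring⟩
  rw [Ideal.isUnit_iff] at hunit
  rw [hE, hunit, Ideal.mul_top]

end pgsD

lemma pgs_ff_sum {K : Type*} [Field K] [Fintype K] (hK : ringChar K ≠ 2) (f : K → ℂ) :
    ∑ t, f (t ^ 2) = ∑ s, ((quadraticChar K s : ℤ) + 1 : ℂ) * f s := by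
  rw [← Finset.sum_fiberwise Finset.univ (fun t : K => t ^ 2)]
  refine Finset.sum_congr rfl fun s _ => ?_
  have h := quadraticChar_card_sqrts hK s
  have h2 : ((quadraticChar K s : ℤ) + 1 : ℂ) = ((Finset.univ.filter (fun t : K => t ^ 2 = s)).card : ℂ) := by
    have : (((Finset.univ.filter (fun t : K => t ^ 2 = s)).card : ℤ)) = quadraticChar K s + 1 := by
      rw [← h]
      congr 2
      ext t
      simp
    have h3 := congrArg (fun n : ℤ => (n : ℂ)) this
    push_cast at h3
    exact h3.symm
  rw [h2, ← nsmul_eq_mul]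
  apply Finset.sum_eq_card_nsmul
  intro t ht
  rw [(Finset.mem_filter.mp ht).2]

lemma pgs_ff_nonsq {K : Type*} [Field K] [Fintype K] (hK : ringChar K ≠ 2) (χ : AddChar K ℂ)
    (hχ : χ ≠ 1) (ε : K) (hε : ¬ IsSquare ε) :
    ∑ t, χ (ε * t ^ 2) = - ∑ t, χ (t ^ 2) := by
  have hε0 : ε ≠ 0 := by rintro rfl; exact hε IsSquare.zero
  have hη := quadraticChar_neg_one_iff_not_isSquare.mpr hε
  have hbij : Function.Bijective (fun s : K => ε * s) := mulLeft_bijective₀ ε hε0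
  have h1 := pgs_ff_sum hK (fun s => χ s)
  have h2 := pgs_ff_sum hK (fun s => χ (ε * s))
  have h3 : ∑ s, ((quadraticChar K s : ℤ) + 1 : ℂ) * χ s =
      ∑ s, ((quadraticChar K (ε * s) : ℤ) + 1 : ℂ) * χ (ε * s) :=
    (Fintype.sum_bijective _ hbij _ _ fun s => rfl).symm
  have h4 : ∑ s, χ (ε * s) = 0 := by
    rw [Fintype.sum_bijective _ hbij (fun s => χ (ε * s)) χ fun s => rfl]
    exact AddChar.sum_eq_zero_of_ne_one hχ
  rw [h1, h2, h3, eq_neg_iff_add_eq_zero, ← Finset.sum_add_distrib]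
  rw [← mul_zero (2 : ℂ), ← h4, Finset.mul_sum]
  refine Finset.sum_congr rfl fun s _ => ?_
  rw [map_mul (quadraticChar K), hη]
  push_cast
  ring

lemma pgs_ff_sq {K : Type*} [Field K] [Fintype K] (χ : AddChar K ℂ)
    (ε : K) (hε0 : ε ≠ 0) (hε : IsSquare ε) :
    ∑ t, χ (ε * t ^ 2) = ∑ t, χ (t ^ 2) := by
  obtain ⟨u, rfl⟩ := hε
  have hu : u ≠ 0 := by rintro rfl; simp at hε0
  refine Fintype.sum_bijective (fun s : K => u * s) (mulLeft_bijective₀ u hu) _ _ fun s => ?_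
  congr 1
  ring

section pgsE
set_option linter.style.haveILetI false
set_option linter.unusedSectionVars false
variable {F : Type*} [Field F] [NumberField F] {k : Type*} [Field k] [NumberField k] [Algebra F k]

lemma pgs_b_smul_left (σ : k ≃ₐ[F] k) (c : F) (t : 𝓞 F) (x y : k) :
    pgs_b σ c (t • x) y = pgs_b σ (c * t) x y := by
  rw [pgs_b_apply, pgs_b_apply]
  congr 1
  rw [Algebra.smul_def, IsScalarTower.algebraMap_apply (𝓞 F) F k, map_mul]
  ring

lemma pgs_b_smul_right (σ : k ≃ₐ[F] k) (c : F) (t : 𝓞 F) (x y : k) :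
    pgs_b σ c x (t • y) = pgs_b σ (c * t) x y := by
  rw [pgs_b_apply, pgs_b_apply]
  congr 1
  rw [Algebra.smul_def, IsScalarTower.algebraMap_apply (𝓞 F) F k, map_mul, map_mul, σ.commutes]
  ring

/-- the character attached to `y` -/
lemma pgs_char (p : Ideal (𝓞 F)) (z : F)
    (hz : ∀ t ∈ p, ∃ n : ℤ, Algebra.trace ℚ F (t * z) = n) :
    ∃ χ : AddChar (𝓞 F ⧸ p) ℂ, ∀ t : 𝓞 F,
      χ (Ideal.Quotient.mk p t) = pgs_e (Algebra.trace ℚ F (t * z)) := by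
  have key : ∀ s t : 𝓞 F, Ideal.Quotient.mk p s = Ideal.Quotient.mk p t →
      pgs_e (Algebra.trace ℚ F (s * z)) = pgs_e (Algebra.trace ℚ F (t * z)) := by
    intro s t h
    rw [Ideal.Quotient.eq] at h
    rw [← pgs_e_add_int (Algebra.trace ℚ F (t * z)) _ (hz _ h), ← map_add, ← add_mul]
    congr 3
    simp
  let f : 𝓞 F ⧸ p → ℂ := fun t => pgs_e (Algebra.trace ℚ F ((Quotient.out t : 𝓞 F) * z))
  have hf : ∀ t : 𝓞 F, f (Ideal.Quotient.mk p t) = pgs_e (Algebra.trace ℚ F (t * z)) :=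
    fun t => key _ _ (Quotient.out_eq _)
  refine ⟨⟨f, ?_, ?_⟩, hf⟩
  · have := hf 0
    rw [map_zero] at this
    rw [this]
    simp [pgs_e_zero]
  · intro s t
    obtain ⟨s, rfl⟩ := Ideal.Quotient.mk_surjective s
    obtain ⟨t, rfl⟩ := Ideal.Quotient.mk_surjective t
    rw [← map_add, hf, hf, hf, ← pgs_e_add, ← map_add, ← add_mul]
    simp

theorem pgs_contra (hdeg : Module.finrank F k = 2)
    (hinf : ∀ φ : F →+* ℝ, ∃ ψ : k →+* ℝ, ψ.comp (algebraMap F k) = φ)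
    (σ : k ≃ₐ[F] k) (hσ : ∀ x, σ (σ x) = x)
    (htr : ∀ x, algebraMap F k (Algebra.trace F k x) = x + σ x)
    (hN : ∀ x, algebraMap F k (Algebra.norm F x) = x * σ x) (c : F) (hc : c ≠ 0)
    (p₁ p₂ : Ideal (𝓞 F)) (hp1 : p₁.IsPrime) (hp2 : p₂.IsPrime) (hp10 : p₁ ≠ ⊥) (hp20 : p₂ ≠ ⊥)
    (h22 : (2 : 𝓞 F) ∉ p₂)
    (L M₁ M₂ M : Submodule (𝓞 F) k) (hL1 : L ≤ M₁) (h1M : M₁ ≤ M) (h2M : M₂ ≤ M)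
    (hsup : ∀ x ∈ M, ∃ y ∈ M₁, ∃ z ∈ M₂, x = y + z) (hinter : ∀ x ∈ M₁, x ∈ M₂ → x ∈ L)
    (hLfull : ∀ x : k, ∃ n : ℤ, n ≠ 0 ∧ (n : ℚ) • x ∈ L)
    (hLq : ∀ x ∈ L, ∀ t : 𝓞 F, ∃ n : ℤ, Algebra.trace ℚ F (t * (c * Algebra.norm F x)) = n)
    (hM : ∀ x, x ∈ M ↔ ∀ y ∈ L, ∃ n : ℤ, pgs_b σ c x y = n)
    (hdd : ∀ x, (∀ y ∈ M, ∃ n : ℤ, pgs_b σ c x y = n) → x ∈ L)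
    (h12 : ∀ x ∈ M₁, ∀ y ∈ M₂, ∃ n : ℤ, pgs_b σ c y x = n)
    (y₁ y₂ : k) (hy1 : y₁ ∈ M₁) (hy2 : y₂ ∈ M₂)
    (hg1 : ∀ x ∈ M₁, ∃ t : 𝓞 F, x - t • y₁ ∈ L) (hg2 : ∀ x ∈ M₂, ∃ t : 𝓞 F, x - t • y₂ ∈ L)
    (ht1 : ∀ t : 𝓞 F, t • y₁ ∈ L ↔ t ∈ p₁) (ht2 : ∀ t : 𝓞 F, t • y₂ ∈ L ↔ t ∈ p₂)
    (hχ1 : ∀ t ∈ p₁, ∃ n : ℤ, Algebra.trace ℚ F (t * (c * Algebra.norm F y₁)) = n)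
    (hχ2 : ∀ t ∈ p₂, ∃ n : ℤ, Algebra.trace ℚ F (t * (c * Algebra.norm F y₂)) = n)
    (ε : (𝓞 F)ˣ) (he1 : IsSquare (Ideal.Quotient.mk p₁ (ε : 𝓞 F)))
    (he2 : ¬ IsSquare (Ideal.Quotient.mk p₂ (ε : 𝓞 F))) : False := by
  haveI := hp1.isMaximal hp10
  haveI := hp2.isMaximal hp20
  letI : Field (𝓞 F ⧸ p₁) := Ideal.Quotient.field p₁
  letI : Field (𝓞 F ⧸ p₂) := Ideal.Quotient.field p₂
  haveI : Finite (𝓞 F ⧸ p₁) := Ideal.finiteQuotientOfFreeOfNeBot p₁ hp10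
  haveI : Finite (𝓞 F ⧸ p₂) := Ideal.finiteQuotientOfFreeOfNeBot p₂ hp20
  letI : Fintype (𝓞 F ⧸ p₁) := Fintype.ofFinite _
  letI : Fintype (𝓞 F ⧸ p₂) := Fintype.ofFinite _
  obtain ⟨χ₁, hX1⟩ := pgs_char p₁ _ hχ1
  obtain ⟨χ₂, hX2⟩ := pgs_char p₂ _ hχ2
  have hout1 : ∀ t : 𝓞 F ⧸ p₁, Ideal.Quotient.mk p₁ (Quotient.out t : 𝓞 F) = t :=
    fun t => Quotient.out_eq t
  have hout2 : ∀ t : 𝓞 F ⧸ p₂, Ideal.Quotient.mk p₂ (Quotient.out t : 𝓞 F) = t :=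
    fun t => Quotient.out_eq t
  have hrep1 : pgs_IsRep L.toAddSubgroup M₁.toAddSubgroup
      (fun t : 𝓞 F ⧸ p₁ => (Quotient.out t : 𝓞 F) • y₁) := by
    refine ⟨fun t => M₁.smul_mem _ hy1, fun x hx => ?_⟩
    obtain ⟨t, ht⟩ := hg1 x hx
    refine ⟨Ideal.Quotient.mk p₁ t, ?_, ?_⟩
    · have h1 : t - (Quotient.out (Ideal.Quotient.mk p₁ t) : 𝓞 F) ∈ p₁ := by
        rw [← Ideal.Quotient.eq, hout1]
      have := L.add_mem ht ((ht1 _).mpr h1)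
      rw [sub_smul] at this
      simpa using this
    · intro s hs
      have := L.sub_mem hs ht
      rw [sub_sub_sub_cancel_left, ← sub_smul, ht1, ← Ideal.Quotient.eq, hout1] at this
      exact this.symm
  have hrep2 : pgs_IsRep M₁.toAddSubgroup M.toAddSubgroup
      (fun t : 𝓞 F ⧸ p₂ => (Quotient.out t : 𝓞 F) • y₂) := by
    refine ⟨fun t => h2M (M₂.smul_mem _ hy2), fun x hx => ?_⟩
    obtain ⟨y, hy, z, hz, rfl⟩ := hsup x hx
    obtain ⟨t, ht⟩ := hg2 z hz
    refine ⟨Ideal.Quotient.mk p₂ t, ?_, ?_⟩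
    · have h1 : t - (Quotient.out (Ideal.Quotient.mk p₂ t) : 𝓞 F) ∈ p₂ := by
        rw [← Ideal.Quotient.eq, hout2]
      have := M₁.add_mem hy (hL1 (L.add_mem ht ((ht2 _).mpr h1)))
      rw [sub_smul] at this
      simpa [add_sub_assoc] using this
    · intro s hs
      have h1 := M₁.sub_mem (M₁.sub_mem hs hy) (hL1 ht)
      have h2 : y + z - (Quotient.out s : 𝓞 F) • y₂ - y - (z - t • y₂) =
        (t - (Quotient.out s : 𝓞 F)) • y₂ := by rw [sub_smul]; abel
      simp only at h1
      rw [h2] at h1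
      have h3 := hinter _ h1 (M₂.smul_mem _ hy2)
      rw [ht2, ← Ideal.Quotient.eq, hout2] at h3
      exact h3.symm
  have hrep := pgs_rep_prod hrep1 hrep2 hL1 h1M
  have hbu : ∀ (e : (𝓞 F)ˣ), ∀ x y, pgs_b σ (c * (e : 𝓞 F)) x y = pgs_b σ c ((e : 𝓞 F) • x) y :=
    fun e x y => (pgs_b_smul_left σ c _ x y).symm
  have hpos : ∀ e : (𝓞 F)ˣ, ∃ r : ℝ, 0 < r ∧
      (∑ t, χ₂ (Ideal.Quotient.mk p₂ (e : 𝓞 F) * t ^ 2)) *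
      (∑ t, χ₁ (Ideal.Quotient.mk p₁ (e : 𝓞 F) * t ^ 2)) = r := by
    intro e
    have he0 : (((e : 𝓞 F)) : F) ≠ 0 := by
      have : (e : 𝓞 F) ≠ 0 := e.ne_zero
      exact_mod_cast this
    have hA : ∀ x ∈ L.toAddSubgroup, ∃ n : ℤ, pgs_b σ (c * (e : 𝓞 F)) x x / 2 = n := by
      intro x hx
      obtain ⟨n, hn⟩ := hLq x hx e
      refine ⟨n, ?_⟩
      rw [pgs_b_self σ hσ htr hN, ← hn]
      congr 1
      ring
    have hB : ∀ x, x ∈ M.toAddSubgroup ↔ ∀ y ∈ L.toAddSubgroup, ∃ n : ℤ, pgs_b σ (c * (e : 𝓞 F)) x y = n := by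
      intro x
      have : x ∈ M ↔ (e : 𝓞 F) • x ∈ M := by
        refine ⟨fun h => M.smul_mem _ h, fun h => ?_⟩
        have := M.smul_mem ((e⁻¹ : (𝓞 F)ˣ) : 𝓞 F) h
        rwa [smul_smul, Units.inv_mul, one_smul] at this
      rw [Submodule.mem_toAddSubgroup, this, hM]
      simp only [hbu]
      rfl
    obtain ⟨r, hr, hsum⟩ := pgs_G_pos hdeg hinf σ hσ htr (c * (e : 𝓞 F)) (mul_ne_zero hc he0)
      L.toAddSubgroup M.toAddSubgroup hLfull hA hB _ hrep
    · refine ⟨r, hr, ?_⟩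
      rw [← hsum, Fintype.sum_prod_type, Finset.sum_mul_sum]
      refine Finset.sum_congr rfl fun t _ => Finset.sum_congr rfl fun s _ => ?_
      have e1 : χ₂ (Ideal.Quotient.mk p₂ (e : 𝓞 F) * t ^ 2) =
          pgs_e (pgs_b σ (c * (e : 𝓞 F)) ((Quotient.out t : 𝓞 F) • y₂) ((Quotient.out t : 𝓞 F) • y₂) / 2) := by
        rw [pgs_b_smul_left, pgs_b_smul_right, pgs_b_self σ hσ htr hN]
        nth_rewrite 1 [← hout2 t]
        rw [← map_pow, ← map_mul, hX2]
        congr 2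
        push_cast
        ring
      have e2 : χ₁ (Ideal.Quotient.mk p₁ (e : 𝓞 F) * s ^ 2) =
          pgs_e (pgs_b σ (c * (e : 𝓞 F)) ((Quotient.out s : 𝓞 F) • y₁) ((Quotient.out s : 𝓞 F) • y₁) / 2) := by
        rw [pgs_b_smul_left, pgs_b_smul_right, pgs_b_self σ hσ htr hN]
        nth_rewrite 1 [← hout1 s]
        rw [← map_pow, ← map_mul, hX1]
        congr 2
        push_cast
        ring
      rw [e1, e2, ← pgs_e_add]
      obtain ⟨n, hn⟩ := h12 ((Quotient.out s : 𝓞 F) • y₁) (M₁.smul_mem _ hy1)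
        ((e : 𝓞 F) • (Quotient.out t : 𝓞 F) • y₂) (M₂.smul_mem _ (M₂.smul_mem _ hy2))
      rw [← hbu] at hn
      rw [← pgs_e_add_int _ (n : ℚ) ⟨n, rfl⟩, ← hn]
      congr 1
      simp only [map_add, LinearMap.add_apply]
      rw [pgs_b_symm σ hσ htr _ ((Quotient.out s : 𝓞 F) • y₁) ((Quotient.out t : 𝓞 F) • y₂)]
      ring
  have hchar : ringChar (𝓞 F ⧸ p₂) ≠ 2 := by
    intro h
    apply h22
    rw [← Ideal.Quotient.eq_zero_iff_mem, map_ofNat]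
    have := ringChar.Nat.cast_ringChar (R := 𝓞 F ⧸ p₂)
    rw [h] at this
    exact_mod_cast this
  have hχne : χ₂ ≠ 1 := by
    intro h
    have hy : y₂ ∈ L := by
      apply hdd
      intro y hy
      obtain ⟨a, ha, b, hb, rfl⟩ := hsup y hy
      obtain ⟨t, ht⟩ := hg2 b hb
      obtain ⟨n1, hn1⟩ := h12 a ha y₂ hy2
      obtain ⟨n2, hn2⟩ := (hM y₂).mp (h2M hy2) _ ht
      obtain ⟨n3, hn3⟩ : ∃ n : ℤ, Algebra.trace ℚ F (t * (c * Algebra.norm F y₂)) = n := by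
        rw [← pgs_e_eq_one, ← hX2, h]
        rfl
      refine ⟨n1 + n2 + 2 * n3, ?_⟩
      have h5 : pgs_b σ c y₂ (t • y₂) = 2 * n3 := by
        rw [pgs_b_smul_right, ← hn3, ← mul_assoc, mul_comm (t : F) c, ← pgs_b_self σ hσ htr hN]
        ring
      have h6 : a + b = a + (b - t • y₂) + t • y₂ := by abel
      rw [h6, map_add, map_add, hn1, hn2, h5]
      push_cast
      ring
    have := (ht2 1).mp (by rwa [one_smul])
    exact hp2.ne_top ((Ideal.eq_top_iff_one _).mpr this)
  obtain ⟨r, hr, h1⟩ := hpos 1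
  obtain ⟨s, hs, h2⟩ := hpos ε
  have hε0 : Ideal.Quotient.mk p₁ (ε : 𝓞 F) ≠ 0 :=
    ((ε.isUnit).map (Ideal.Quotient.mk p₁)).ne_zero
  rw [pgs_ff_sq χ₁ _ hε0 he1, pgs_ff_nonsq hchar χ₂ hχne _ he2] at h2
  simp only [Units.val_one, map_one, one_mul] at h1
  rw [neg_mul, h1] at h2
  have : -r = s := by exact_mod_cast h2
  linarith

end pgsE

section pgsF
set_option linter.unusedSectionVars false
set_option linter.style.haveILetI false
open nonZeroDivisors
variable {F : Type*} [Field F] [NumberField F] {k : Type*} [Field k] [NumberField k] [Algebra F k]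

/-- stability of a fractional ideal under `σ` -/
def pgs_St (σ : k ≃ₐ[F] k) (I : FractionalIdeal (𝓞 k)⁰ k) : Prop := ∀ x ∈ I, σ x ∈ I

lemma pgs_exists_coe (σ : k ≃ₐ[F] k) (x : 𝓞 k) : ∃ y : 𝓞 k, algebraMap (𝓞 k) k y = σ (algebraMap (𝓞 k) k x) := by
  have h1 : IsIntegral ℤ (σ (algebraMap (𝓞 k) k x)) :=
    (RingOfIntegers.isIntegral_coe x).map σ.toRingEquiv.toRingHom.toIntAlgHom
  exact ⟨⟨_, h1⟩, rfl⟩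

lemma pgs_St_one (σ : k ≃ₐ[F] k) : pgs_St σ 1 := by
  intro x hx
  rw [FractionalIdeal.mem_one_iff] at hx ⊢
  obtain ⟨x, rfl⟩ := hx
  exact pgs_exists_coe σ x

lemma pgs_St_mul (σ : k ≃ₐ[F] k) {I J : FractionalIdeal (𝓞 k)⁰ k} (hI : pgs_St σ I)
    (hJ : pgs_St σ J) : pgs_St σ (I * J) := by
  intro x hx
  refine FractionalIdeal.mul_induction_on (C := fun x => σ x ∈ I * J) hx ?_ ?_
  · intro i hi j hj
    rw [map_mul]
    exact FractionalIdeal.mul_mem_mul (hI i hi) (hJ j hj)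
  · intro x y hx hy
    rw [map_add]
    exact Submodule.add_mem (I * J : FractionalIdeal (𝓞 k)⁰ k).coeToSubmodule hx hy

lemma pgs_St_inv (σ : k ≃ₐ[F] k) (hσ : ∀ x, σ (σ x) = x) {I : FractionalIdeal (𝓞 k)⁰ k}
    (hI0 : I ≠ 0) (hI : pgs_St σ I) : pgs_St σ I⁻¹ := by
  intro x hx
  rw [FractionalIdeal.mem_inv_iff hI0] at hx ⊢
  intro y hy
  have := pgs_St_one σ _ (hx _ (hI y hy))
  rwa [map_mul, hσ] at this

lemma pgs_St_map (σ : k ≃ₐ[F] k) (J : Ideal (𝓞 F)) :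
    pgs_St σ ((J.map (algebraMap (𝓞 F) (𝓞 k)) : Ideal (𝓞 k)) : FractionalIdeal (𝓞 k)⁰ k) := by
  intro x hx
  rw [FractionalIdeal.mem_coeIdeal] at hx
  obtain ⟨x, hx, rfl⟩ := hx
  induction hx using Submodule.span_induction with
  | mem x h =>
    obtain ⟨a, ha, rfl⟩ := h
    rw [← IsScalarTower.algebraMap_apply (𝓞 F) (𝓞 k) k, IsScalarTower.algebraMap_apply (𝓞 F) F k,
      σ.commutes, ← IsScalarTower.algebraMap_apply (𝓞 F) F k,
      IsScalarTower.algebraMap_apply (𝓞 F) (𝓞 k) k]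
    exact FractionalIdeal.mem_coeIdeal_of_mem _ (Ideal.mem_map_of_mem _ ha)
  | zero => simp
  | add x y _ _ hx hy =>
    rw [map_add, map_add]
    exact Submodule.add_mem (FractionalIdeal.coeToSubmodule _) hx hy
  | smul a x _ hx =>
    obtain ⟨b, hb⟩ := pgs_exists_coe σ a
    rw [smul_eq_mul, map_mul, map_mul, ← hb, ← Algebra.smul_def]
    exact Submodule.smul_mem (FractionalIdeal.coeToSubmodule _) b hx

lemma pgs_St_P (σ : k ≃ₐ[F] k) (p : Ideal (𝓞 F)) (P : Ideal (𝓞 k)) (hP : P.IsPrime)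
    (h : P ^ 2 = p.map (algebraMap (𝓞 F) (𝓞 k))) :
    pgs_St σ (P : FractionalIdeal (𝓞 k)⁰ k) := by
  intro x hx
  rw [FractionalIdeal.mem_coeIdeal] at hx
  obtain ⟨x, hx, rfl⟩ := hx
  obtain ⟨y, hy⟩ := pgs_exists_coe σ x
  rw [← hy]
  apply FractionalIdeal.mem_coeIdeal_of_mem
  apply hP.mem_of_pow_mem 2
  have h1 := pgs_St_map σ p (algebraMap (𝓞 k) k (x ^ 2))
    (FractionalIdeal.mem_coeIdeal_of_mem _ (h ▸ Ideal.pow_mem_pow hx 2))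
  rw [map_pow, map_pow, ← hy, ← map_pow, FractionalIdeal.mem_coeIdeal] at h1
  obtain ⟨z, hz, hzy⟩ := h1
  have : z = y ^ 2 := FaithfulSMul.algebraMap_injective (𝓞 k) k hzy
  rw [← this]
  rw [← h] at hz
  exact Ideal.pow_le_self two_ne_zero hz

/-- integrality of traces from `k` -/
lemma pgs_Tk (B T D C : FractionalIdeal (𝓞 k)⁰ k) (hB : B ≠ 0) (hT : T ≠ 0)
    (hdual : FractionalIdeal.dual ℤ ℚ (1 : FractionalIdeal (𝓞 k)⁰ k) = D⁻¹ * T⁻¹)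
    (c : k) (hc : FractionalIdeal.spanSingleton (𝓞 k)⁰ c = C) (hC : C * (B * B * T) = 1) (w : k)
    (hw : w ∈ B * B * D⁻¹) : ∃ n : ℤ, Algebra.trace ℚ k (c * w) = n := by
  have h1 : c * w ∈ FractionalIdeal.dual ℤ ℚ (1 : FractionalIdeal (𝓞 k)⁰ k) := by
    have h2 : c * w ∈ C * (B * B * D⁻¹) := FractionalIdeal.mul_mem_mul
      (hc ▸ FractionalIdeal.mem_spanSingleton_self _ c) hw
    have h3 : C * (B * B * D⁻¹) = D⁻¹ * T⁻¹ := by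
      have : C = (B * B * T)⁻¹ := eq_inv_of_mul_eq_one_left hC
      rw [this]
      field_simp
    rwa [h3, ← hdual] at h2
  have h10 : (1 : FractionalIdeal (𝓞 k)⁰ k) ≠ 0 := one_ne_zero
  rw [FractionalIdeal.mem_dual h10] at h1
  obtain ⟨n, hn⟩ := h1 1 (FractionalIdeal.one_mem_one _)
  refine ⟨n, ?_⟩
  rw [Algebra.traceForm_apply, mul_one] at hn
  rw [← hn]; simp

lemma pgs_dualmem (σ : k ≃ₐ[F] k) (B T D C I : FractionalIdeal (𝓞 k)⁰ k) (hB : B ≠ 0) (hT : T ≠ 0)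
    (hI : I ≠ 0) (hσ : ∀ x, σ (σ x) = x) (hSI : pgs_St σ I)
    (hdual : FractionalIdeal.dual ℤ ℚ (1 : FractionalIdeal (𝓞 k)⁰ k) = D⁻¹ * T⁻¹)
    (c : F) (hc0 : c ≠ 0) (hc : FractionalIdeal.spanSingleton (𝓞 k)⁰ (algebraMap F k c) = C)
    (hC : C * (B * B * T) = 1) (x : k)
    (hx : ∀ y ∈ I, ∃ n : ℤ, pgs_b σ c x y = n) : x ∈ B * B * D⁻¹ * I⁻¹ := by
  have h1 : algebraMap F k c * x ∈ FractionalIdeal.dual ℤ ℚ I := by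
    rw [FractionalIdeal.mem_dual hI]
    intro a ha
    obtain ⟨n, hn⟩ := hx _ (hSI a ha)
    rw [pgs_b_apply, hσ] at hn
    rw [Algebra.traceForm_apply, mul_assoc, hn]
    exact ⟨n, by simp⟩
  rw [FractionalIdeal.dual_eq_mul_inv, hdual] at h1
  have hc' : algebraMap F k c ≠ 0 := (map_ne_zero (algebraMap F k)).mpr hc0
  have hCinv : C⁻¹ = B * B * T := (eq_inv_of_mul_eq_one_right hC).symm
  have h2 : (algebraMap F k c)⁻¹ ∈ B * B * T := by
    rw [← hCinv, ← hc, FractionalIdeal.spanSingleton_inv]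
    exact FractionalIdeal.mem_spanSingleton_self _ _
  have h3 := FractionalIdeal.mul_mem_mul h2 h1
  rw [inv_mul_cancel_left₀ hc'] at h3
  convert h3 using 1
  field_simp

/-- integrality of traces from `F` -/
lemma pgs_TF (B C : FractionalIdeal (𝓞 k)⁰ k) (d : Ideal (𝓞 F)) (hd : d = differentIdeal ℤ (𝓞 F))
    (c : F) (hc : FractionalIdeal.spanSingleton (𝓞 k)⁰ (algebraMap F k c) = C)
    (hC : C * (B * B * ((d.map (algebraMap (𝓞 F) (𝓞 k)) : Ideal (𝓞 k)) : FractionalIdeal (𝓞 k)⁰ k)) = 1)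
    (z : F) (hz : algebraMap F k z ∈ B * B) (t : 𝓞 F) :
    ∃ n : ℤ, Algebra.trace ℚ F (t * (c * z)) = n := by
  have hd0 : d ≠ ⊥ := hd ▸ differentIdeal_ne_bot
  have h1 : c * z ∈ FractionalIdeal.dual ℤ ℚ (1 : FractionalIdeal (𝓞 F)⁰ F) := by
    rw [← inv_inv (FractionalIdeal.dual ℤ ℚ (1 : FractionalIdeal (𝓞 F)⁰ F)),
      ← coeIdeal_differentIdeal, ← hd,
      FractionalIdeal.mem_inv_iff (FractionalIdeal.coeIdeal_ne_zero.mpr hd0)]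
    intro y hy
    rw [FractionalIdeal.mem_coeIdeal] at hy
    obtain ⟨y, hy, rfl⟩ := hy
    have h2 : algebraMap (𝓞 k) k (algebraMap (𝓞 F) (𝓞 k) y) ∈
        ((d.map (algebraMap (𝓞 F) (𝓞 k)) : Ideal (𝓞 k)) : FractionalIdeal (𝓞 k)⁰ k) :=
      FractionalIdeal.mem_coeIdeal_of_mem _ (Ideal.mem_map_of_mem _ hy)
    have h3 := FractionalIdeal.mul_mem_mul (hc ▸ FractionalIdeal.mem_spanSingleton_self _ _ :
      algebraMap F k c ∈ C) (FractionalIdeal.mul_mem_mul hz h2)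
    rw [hC, FractionalIdeal.mem_one_iff] at h3
    obtain ⟨u, hu⟩ := h3
    rw [← IsScalarTower.algebraMap_apply (𝓞 F) (𝓞 k) k, IsScalarTower.algebraMap_apply (𝓞 F) F k,
      ← map_mul, ← map_mul, ← mul_assoc] at hu
    have hint : IsIntegral ℤ (c * z * algebraMap (𝓞 F) F y) := by
      rw [← isIntegral_algHom_iff ((algebraMap F k).toIntAlgHom) (algebraMap F k).injective]
      change IsIntegral ℤ (algebraMap F k _)
      rw [← hu]
      exact RingOfIntegers.isIntegral_coe u
    rw [FractionalIdeal.mem_one_iff]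
    exact ⟨⟨_, hint⟩, rfl⟩
  have h10 : (1 : FractionalIdeal (𝓞 F)⁰ F) ≠ 0 := one_ne_zero
  rw [FractionalIdeal.mem_dual h10] at h1
  obtain ⟨n, hn⟩ := h1 (algebraMap (𝓞 F) F t) ((FractionalIdeal.mem_one_iff _).mpr ⟨t, rfl⟩)
  refine ⟨n, ?_⟩
  rw [Algebra.traceForm_apply, mul_comm] at hn
  rw [← hn.trans rfl]; simp

lemma pgs_gen (p : Ideal (𝓞 F)) (hp : p.IsMaximal) (P : Ideal (𝓞 k)) (hP : P.IsPrime) (hP0 : P ≠ ⊥)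
    (hmem : ∀ s : 𝓞 F, algebraMap (𝓞 F) (𝓞 k) s ∈ P ↔ s ∈ p)
    (hsurj : ∀ t : 𝓞 k, ∃ s : 𝓞 F, t - algebraMap (𝓞 F) (𝓞 k) s ∈ P)
    (B : FractionalIdeal (𝓞 k)⁰ k) (hB : B ≠ 0) :
    ∃ y ∈ B * (P : FractionalIdeal (𝓞 k)⁰ k)⁻¹,
      (∀ x ∈ B * (P : FractionalIdeal (𝓞 k)⁰ k)⁻¹, ∃ t : 𝓞 F, x - t • y ∈ B) ∧
      ∀ t : 𝓞 F, t • y ∈ B ↔ t ∈ p := by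
  set Q : FractionalIdeal (𝓞 k)⁰ k := (P : FractionalIdeal (𝓞 k)⁰ k) with hQ
  have hQ0 : Q ≠ 0 := FractionalIdeal.coeIdeal_ne_zero.mpr hP0
  have hPm : P.IsMaximal := hP.isMaximal hP0
  have hsm : ∀ (t : 𝓞 F) (x : k), t • x = algebraMap (𝓞 k) k (algebraMap (𝓞 F) (𝓞 k) t) * x := by
    intro t x
    rw [Algebra.smul_def, IsScalarTower.algebraMap_apply (𝓞 F) (𝓞 k) k]
  have hBmul : ∀ (t : 𝓞 k) (x : k), x ∈ B → algebraMap (𝓞 k) k t * x ∈ B := by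
    intro t x hx
    rw [← Algebra.smul_def]
    exact Submodule.smul_mem B.coeToSubmodule t hx
  have hadd : ∀ x y : k, x ∈ B → y ∈ B → x + y ∈ B := fun x y hx hy =>
    Submodule.add_mem B.coeToSubmodule hx hy
  have hPB : ∀ t ∈ P, ∀ x ∈ B * Q⁻¹, algebraMap (𝓞 k) k t * x ∈ B := by
    intro t ht x hx
    have := FractionalIdeal.mul_mem_mul (FractionalIdeal.mem_coeIdeal_of_mem (𝓞 k)⁰ ht :
      algebraMap (𝓞 k) k t ∈ Q) hx
    have e : Q * (B * Q⁻¹) = B := by field_simp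
    rwa [e] at this
  obtain ⟨y, hy, hyB⟩ : ∃ y ∈ B * Q⁻¹, y ∉ B := by
    by_contra! hcon
    have h1 : B * Q⁻¹ ≤ B := hcon
    have h2 : (1 : FractionalIdeal (𝓞 k)⁰ k) ≤ Q := by
      have h3 : B⁻¹ * (B * Q⁻¹) * Q ≤ B⁻¹ * B * Q := by gcongr
      have e1 : B⁻¹ * (B * Q⁻¹) * Q = 1 := by field_simp
      have e2 : B⁻¹ * B * Q = Q := by field_simp
      rwa [e1, e2] at h3
    have h4 : (1 : k) ∈ Q := h2 (FractionalIdeal.one_mem_one _)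
    rw [hQ, FractionalIdeal.mem_coeIdeal] at h4
    obtain ⟨u, hu, hu1⟩ := h4
    have : u = 1 := FaithfulSMul.algebraMap_injective (𝓞 k) k (by rw [hu1, map_one])
    exact hP.ne_top ((Ideal.eq_top_iff_one _).mpr (this ▸ hu))
  obtain ⟨g, hg, hgy⟩ : ∃ g ∈ B⁻¹ * Q, y * g ∉ Q := by
    by_contra! hcon
    rw [← FractionalIdeal.spanSingleton_mul_le_iff] at hcon
    apply hyB
    rw [← FractionalIdeal.spanSingleton_le_iff_mem (S := (𝓞 k)⁰)]
    have h3 : FractionalIdeal.spanSingleton (𝓞 k)⁰ y * (B⁻¹ * Q) * (B * Q⁻¹) ≤ Q * (B * Q⁻¹) := by gcongr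
    have e1 : FractionalIdeal.spanSingleton (𝓞 k)⁰ y * (B⁻¹ * Q) * (B * Q⁻¹) =
      FractionalIdeal.spanSingleton (𝓞 k)⁰ y := by field_simp
    have e2 : Q * (B * Q⁻¹) = B := by field_simp
    rwa [e1, e2] at h3
  have hgx : ∀ x ∈ B * Q⁻¹, ∃ u : 𝓞 k, algebraMap (𝓞 k) k u = x * g := by
    intro x hx
    have := FractionalIdeal.mul_mem_mul hx hg
    have e : B * Q⁻¹ * (B⁻¹ * Q) = 1 := by field_simp
    rw [e, FractionalIdeal.mem_one_iff] at this
    exact this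
  obtain ⟨v, hv⟩ := hgx y hy
  have hvP : v ∉ P := by
    intro h
    apply hgy
    rw [← hv]
    exact FractionalIdeal.mem_coeIdeal_of_mem _ h
  obtain ⟨o, π, hπ, ho⟩ := hPm.exists_inv hvP
  refine ⟨y, hy, ?_, ?_⟩
  · intro x hx
    obtain ⟨u, hu⟩ := hgx x hx
    obtain ⟨s, hs⟩ := hsurj (o * u)
    refine ⟨s, ?_⟩
    have h1 := hPB _ hπ x hx
    have h2 := hPB _ hs y hy
    have h3 := hadd _ _ h1 h2
    convert h3 using 1
    have e1 : algebraMap (𝓞 k) k o * (y * g) + algebraMap (𝓞 k) k π = 1 := by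
      rw [← hv, ← map_mul, ← map_add, ho, map_one]
    rw [hsm, map_sub, map_mul, hu]
    linear_combination -x * e1
  · intro t
    constructor
    · intro ht
      by_contra htp
      obtain ⟨s, π', hπ', hs⟩ := hp.exists_inv htp
      apply hyB
      have h1 := hPB _ ((hmem π').mpr hπ') y hy
      rw [hsm] at ht
      have h2 := hadd _ _ (hBmul (algebraMap (𝓞 F) (𝓞 k) s) _ ht) h1
      convert h2 using 1
      have e1 := congrArg (fun x => algebraMap (𝓞 k) k (algebraMap (𝓞 F) (𝓞 k) x)) hs
      simp only [map_add, map_mul, map_one] at e1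
      linear_combination -y * e1
    · intro ht
      rw [hsm]
      exact hPB _ ((hmem t).mpr ht) y hy

end pgsF

section pgsG
set_option linter.unusedSectionVars false
set_option linter.style.haveILetI false
open nonZeroDivisors
variable {F : Type*} [Field F] [NumberField F] {k : Type*} [Field k] [NumberField k] [Algebra F k]

lemma pgs_setup (hoddF : Odd (NumberField.classNumber F)) (d : Ideal (𝓞 F)) (hd0 : d ≠ ⊥) :
    ∃ (m : ℕ) (c : F), c ≠ 0 ∧
      FractionalIdeal.spanSingleton (𝓞 k)⁰ (algebraMap F k c) *
      ((((d ^ m).map (algebraMap (𝓞 F) (𝓞 k)) : Ideal (𝓞 k)) : FractionalIdeal (𝓞 k)⁰ k) *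
      (((d ^ m).map (algebraMap (𝓞 F) (𝓞 k)) : Ideal (𝓞 k)) : FractionalIdeal (𝓞 k)⁰ k) *
      ((d.map (algebraMap (𝓞 F) (𝓞 k)) : Ideal (𝓞 k)) : FractionalIdeal (𝓞 k)⁰ k)) = 1 := by
  obtain ⟨m, hm⟩ := hoddF
  have hpr : (d ^ (2 * m + 1)).IsPrincipal := by
    have hmem : d ∈ (Ideal (𝓞 F))⁰ := mem_nonZeroDivisors_of_ne_zero hd0
    have h1 : ClassGroup.mk0 (⟨d, hmem⟩ : (Ideal (𝓞 F))⁰) ^ (2 * m + 1) = 1 := by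
      rw [← hm]; exact pow_card_eq_one
    rw [← map_pow] at h1
    exact (ClassGroup.mk0_eq_one_iff (pow_mem hmem (2 * m + 1))).mp h1
  obtain ⟨a, ha⟩ := hpr
  have ha' : d ^ (2 * m + 1) = Ideal.span {a} := ha
  have ha0 : a ≠ 0 := by
    rintro rfl
    have : d ^ (2 * m + 1) = 0 := by rw [ha']; simp
    exact hd0 (pow_eq_zero_iff (by omega) |>.mp this)
  have haF : algebraMap (𝓞 F) F a ≠ 0 := by
    rw [Ne, FaithfulSMul.algebraMap_eq_zero_iff]; exact ha0
  refine ⟨m, (algebraMap (𝓞 F) F a)⁻¹, inv_ne_zero haF, ?_⟩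
  rw [← FractionalIdeal.coeIdeal_mul, ← FractionalIdeal.coeIdeal_mul, ← Ideal.map_mul,
    ← Ideal.map_mul]
  have e : d ^ m * d ^ m * d = d ^ (2 * m + 1) := by ring
  rw [e, ha', Ideal.map_span, Set.image_singleton, FractionalIdeal.coeIdeal_span_singleton,
    ← IsScalarTower.algebraMap_apply (𝓞 F) (𝓞 k) k, IsScalarTower.algebraMap_apply (𝓞 F) F k,
    map_inv₀, FractionalIdeal.spanSingleton_mul_spanSingleton, inv_mul_cancel₀,
    FractionalIdeal.spanSingleton_one]
  exact (map_ne_zero _).mpr haF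

lemma pgs_full (I : Ideal (𝓞 k)) (hI : I ≠ ⊥) (x : k) :
    ∃ n : ℤ, n ≠ 0 ∧ (n : ℚ) • x ∈ (I : FractionalIdeal (𝓞 k)⁰ k) := by
  haveI : Algebra.IsAlgebraic ℤ ℚ := IsLocalization.isAlgebraic ℚ ℤ⁰
  haveI : Algebra.IsAlgebraic ℤ k := Algebra.IsAlgebraic.trans ℤ ℚ k
  obtain ⟨y, hy0, hy⟩ := (Algebra.IsAlgebraic.isAlgebraic (R := ℤ) x).exists_integral_multiple
  refine ⟨Ideal.absNorm I * y, mul_ne_zero ?_ hy0, ?_⟩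
  · rw [Nat.cast_ne_zero, Ne, Ideal.absNorm_eq_zero_iff]; exact hI
  · obtain ⟨w, hw⟩ : ∃ w : 𝓞 k, algebraMap (𝓞 k) k w = y • x := ⟨⟨y • x, hy⟩, rfl⟩
    have h1 : w * (Ideal.absNorm I : 𝓞 k) ∈ I :=
      Ideal.mul_mem_left _ _ (Ideal.absNorm_mem I)
    have h2 := FractionalIdeal.mem_coeIdeal_of_mem (P := k) (𝓞 k)⁰ h1
    convert h2 using 1
    rw [map_mul, map_natCast, hw]
    rw [zsmul_eq_mul, Algebra.smul_def]
    push_cast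
    simp
    ring

lemma pgs_two_notMem (p : Ideal (𝓞 F)) (hp : p.IsPrime) (hN : Odd (Ideal.absNorm p)) :
    (2 : 𝓞 F) ∉ p := by
  intro h
  obtain ⟨m, hm⟩ := hN
  have h1 := Ideal.absNorm_mem p
  rw [hm] at h1
  push_cast at h1
  have h2 : (1 : 𝓞 F) ∈ p := (Ideal.add_mem_iff_right p (Ideal.mul_mem_right _ _ h)).mp h1
  exact hp.ne_top ((Ideal.eq_top_iff_one _).mpr h2)

lemma pgs_ne_bot (p : Ideal (𝓞 F)) (hN : Odd (Ideal.absNorm p)) : p ≠ ⊥ := by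
  rintro rfl
  simp at hN

theorem pgs_square (hoddF : Odd (NumberField.classNumber F))
    (hdeg : Module.finrank F k = 2)
    (p₁ p₂ : Ideal (𝓞 F)) (hp1 : p₁.IsPrime) (hp2 : p₂.IsPrime) (hne : p₁ ≠ p₂)
    (hN1 : Odd (Ideal.absNorm p₁)) (hN2 : Odd (Ideal.absNorm p₂))
    (hram : ∀ 𝔭 : Ideal (𝓞 F), 𝔭.IsPrime → 𝔭 ≠ ⊥ →
      (IsRamifiedIn F k 𝔭 ↔ 𝔭 = p₁ ∨ 𝔭 = p₂))
    (hinf : UnramifiedAtInfinitePlaces F k) (ε : (𝓞 F)ˣ)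
    (he1 : IsSquare (Ideal.Quotient.mk p₁ (ε : 𝓞 F))) :
    IsSquare (Ideal.Quotient.mk p₂ (ε : 𝓞 F)) := by
  by_contra he2
  have hp10 := pgs_ne_bot p₁ hN1
  have hp20 := pgs_ne_bot p₂ hN2
  have h21 := pgs_two_notMem p₁ hp1 hN1
  have h22 := pgs_two_notMem p₂ hp2 hN2
  obtain ⟨P₁, hP1, hP10, hP1p, hmem1, hsurj1⟩ :=
    pgs_ram hdeg p₁ hp1 hp10 ((hram p₁ hp1 hp10).mpr (Or.inl rfl))
  obtain ⟨P₂, hP2, hP20, hP2p, hmem2, hsurj2⟩ :=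
    pgs_ram hdeg p₂ hp2 hp20 ((hram p₂ hp2 hp20).mpr (Or.inr rfl))
  have hPne : P₁ ≠ P₂ := by
    rintro rfl
    exact hne (Ideal.ext fun s => (hmem1 s).symm.trans (hmem2 s))
  have hdiff := pgs_diff hdeg p₁ p₂ hp1 hp2 hp10 hp20 h21 h22
    (fun p hp hp0 => (hram p hp hp0).mp) P₁ P₂ hP1 hP2 hP10 hP20 hP1p hP2p hPne
  obtain ⟨σ, hσ, htr, hNm⟩ := pgs_exists_sigma hdeg
  obtain ⟨d, hd⟩ : ∃ d, d = differentIdeal ℤ (𝓞 F) := ⟨_, rfl⟩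
  have hd0 : d ≠ ⊥ := hd ▸ differentIdeal_ne_bot
  obtain ⟨m, c, hc0, hC⟩ := pgs_setup (k := k) hoddF d hd0
  have hinj : Function.Injective (algebraMap (𝓞 F) (𝓞 k)) :=
    FaithfulSMul.algebraMap_injective (𝓞 F) (𝓞 k)
  have hdm0 : (d ^ m).map (algebraMap (𝓞 F) (𝓞 k)) ≠ ⊥ := by
    rw [Ne, Ideal.map_eq_bot_iff_of_injective hinj]
    exact pow_ne_zero m hd0
  have hdT0 : d.map (algebraMap (𝓞 F) (𝓞 k)) ≠ ⊥ := by
    rw [Ne, Ideal.map_eq_bot_iff_of_injective hinj]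
    exact hd0
  have hLfull := pgs_full _ hdm0
  have hSB := pgs_St_map σ (d ^ m)
  have hdual : FractionalIdeal.dual ℤ ℚ (1 : FractionalIdeal (𝓞 k)⁰ k) =
      ((P₁ : FractionalIdeal (𝓞 k)⁰ k) * (P₂ : FractionalIdeal (𝓞 k)⁰ k))⁻¹ *
      ((d.map (algebraMap (𝓞 F) (𝓞 k)) : Ideal (𝓞 k)) : FractionalIdeal (𝓞 k)⁰ k)⁻¹ := by
    rw [← inv_inv (FractionalIdeal.dual ℤ ℚ (1 : FractionalIdeal (𝓞 k)⁰ k)),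
      ← coeIdeal_differentIdeal,
      differentIdeal_eq_differentIdeal_mul_differentIdeal ℤ (𝓞 F) (𝓞 k), hdiff, ← hd,
      FractionalIdeal.coeIdeal_mul, FractionalIdeal.coeIdeal_mul, mul_inv]
  have hTF : ∀ (z : F), _ → ∀ t : 𝓞 F, _ := fun z hz t =>
    pgs_TF _ _ d hd c rfl hC z hz t
  have hB0 : (((d ^ m).map (algebraMap (𝓞 F) (𝓞 k)) : Ideal (𝓞 k)) : FractionalIdeal (𝓞 k)⁰ k) ≠ 0 :=
    FractionalIdeal.coeIdeal_ne_zero.mpr hdm0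
  have hT0 : ((d.map (algebraMap (𝓞 F) (𝓞 k)) : Ideal (𝓞 k)) : FractionalIdeal (𝓞 k)⁰ k) ≠ 0 :=
    FractionalIdeal.coeIdeal_ne_zero.mpr hdT0
  generalize (((d ^ m).map (algebraMap (𝓞 F) (𝓞 k)) : Ideal (𝓞 k)) : FractionalIdeal (𝓞 k)⁰ k) = B at *
  generalize ((d.map (algebraMap (𝓞 F) (𝓞 k)) : Ideal (𝓞 k)) : FractionalIdeal (𝓞 k)⁰ k) = T at *
  have hSQ1 := pgs_St_P σ p₁ P₁ hP1 hP1p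
  have hSQ2 := pgs_St_P σ p₂ P₂ hP2 hP2p
  have hQ10 : (P₁ : FractionalIdeal (𝓞 k)⁰ k) ≠ 0 := FractionalIdeal.coeIdeal_ne_zero.mpr hP10
  have hQ20 : (P₂ : FractionalIdeal (𝓞 k)⁰ k) ≠ 0 := FractionalIdeal.coeIdeal_ne_zero.mpr hP20
  obtain ⟨y₁, hy1, hg1, ht1⟩ := pgs_gen p₁ (hp1.isMaximal hp10) P₁ hP1 hP10 hmem1 hsurj1 B hB0
  obtain ⟨y₂, hy2, hg2, ht2⟩ := pgs_gen p₂ (hp2.isMaximal hp20) P₂ hP2 hP20 hmem2 hsurj2 B hB0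
  have hpQ1 : ∀ t ∈ p₁, algebraMap F k (algebraMap (𝓞 F) F t) ∈
      (P₁ : FractionalIdeal (𝓞 k)⁰ k) * (P₁ : FractionalIdeal (𝓞 k)⁰ k) := by
    intro t ht
    rw [← FractionalIdeal.coeIdeal_mul, ← pow_two, hP1p,
      ← IsScalarTower.algebraMap_apply (𝓞 F) F k, IsScalarTower.algebraMap_apply (𝓞 F) (𝓞 k) k]
    exact FractionalIdeal.mem_coeIdeal_of_mem _ (Ideal.mem_map_of_mem _ ht)
  have hpQ2 : ∀ t ∈ p₂, algebraMap F k (algebraMap (𝓞 F) F t) ∈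
      (P₂ : FractionalIdeal (𝓞 k)⁰ k) * (P₂ : FractionalIdeal (𝓞 k)⁰ k) := by
    intro t ht
    rw [← FractionalIdeal.coeIdeal_mul, ← pow_two, hP2p,
      ← IsScalarTower.algebraMap_apply (𝓞 F) F k, IsScalarTower.algebraMap_apply (𝓞 F) (𝓞 k) k]
    exact FractionalIdeal.mem_coeIdeal_of_mem _ (Ideal.mem_map_of_mem _ ht)
  obtain ⟨a, b, ha, hb, hab⟩ : ∃ a b : k, a ∈ (P₁ : FractionalIdeal (𝓞 k)⁰ k) ∧
      b ∈ (P₂ : FractionalIdeal (𝓞 k)⁰ k) ∧ a + b = 1 := by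
    haveI := hP1.isMaximal hP10
    haveI := hP2.isMaximal hP20
    obtain ⟨a, ha, b, hb, hab⟩ := Ideal.isCoprime_iff_exists.mp (Ideal.isCoprime_of_isMaximal hPne)
    exact ⟨_, _, FractionalIdeal.mem_coeIdeal_of_mem _ ha, FractionalIdeal.mem_coeIdeal_of_mem _ hb,
      by rw [← map_add, hab, map_one]⟩
  have hQ1le : (P₁ : FractionalIdeal (𝓞 k)⁰ k) ≤ 1 := FractionalIdeal.coeIdeal_le_one
  have hQ2le : (P₂ : FractionalIdeal (𝓞 k)⁰ k) ≤ 1 := FractionalIdeal.coeIdeal_le_one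
  generalize (P₁ : FractionalIdeal (𝓞 k)⁰ k) = Q₁ at *
  generalize (P₂ : FractionalIdeal (𝓞 k)⁰ k) = Q₂ at *
  have hone1 : 1 ≤ Q₁⁻¹ := by
    have : Q₁ * Q₁⁻¹ ≤ 1 * Q₁⁻¹ := by gcongr
    rwa [mul_inv_cancel₀ hQ10, one_mul] at this
  have hone2 : 1 ≤ Q₂⁻¹ := by
    have : Q₂ * Q₂⁻¹ ≤ 1 * Q₂⁻¹ := by gcongr
    rwa [mul_inv_cancel₀ hQ20, one_mul] at this
  have hD0 : Q₁ * Q₂ ≠ 0 := mul_ne_zero hQ10 hQ20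
  have hLM1 : B ≤ B * Q₁⁻¹ := by
    calc B = B * 1 := (mul_one B).symm
      _ ≤ B * Q₁⁻¹ := by gcongr
  have hM1M : B * Q₁⁻¹ ≤ B * (Q₁ * Q₂)⁻¹ := by
    calc B * Q₁⁻¹ = B * Q₁⁻¹ * 1 := (mul_one _).symm
      _ ≤ B * Q₁⁻¹ * Q₂⁻¹ := by gcongr
      _ = B * (Q₁ * Q₂)⁻¹ := by rw [mul_inv, mul_assoc]
  have hM2M : B * Q₂⁻¹ ≤ B * (Q₁ * Q₂)⁻¹ := by
    calc B * Q₂⁻¹ = B * Q₂⁻¹ * 1 := (mul_one _).symm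
      _ ≤ B * Q₂⁻¹ * Q₁⁻¹ := by gcongr
      _ = B * (Q₁ * Q₂)⁻¹ := by rw [mul_inv, mul_assoc, mul_comm Q₂⁻¹]
  have hSM : pgs_St σ (B * (Q₁ * Q₂)⁻¹) :=
    pgs_St_mul σ hSB (pgs_St_inv σ hσ hD0 (pgs_St_mul σ hSQ1 hSQ2))
  have hSM1 : pgs_St σ (B * Q₁⁻¹) := pgs_St_mul σ hSB (pgs_St_inv σ hσ hQ10 hSQ1)
  have hSM2 : pgs_St σ (B * Q₂⁻¹) := pgs_St_mul σ hSB (pgs_St_inv σ hσ hQ20 hSQ2)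
  have hM0 : B * (Q₁ * Q₂)⁻¹ ≠ 0 := mul_ne_zero hB0 (inv_ne_zero hD0)
  have hχ : ∀ (p : Ideal (𝓞 F)) (Q : FractionalIdeal (𝓞 k)⁰ k) (y : k), Q ≠ 0 →
      (∀ t ∈ p, algebraMap F k (algebraMap (𝓞 F) F t) ∈ Q * Q) → pgs_St σ (B * Q⁻¹) →
      y ∈ B * Q⁻¹ → ∀ t ∈ p, ∃ n : ℤ, Algebra.trace ℚ F (t * (c * Algebra.norm F y)) = n := by
    intro p Q y hQ0 hpQ hS hy t ht
    obtain ⟨n, hn⟩ := hTF (algebraMap (𝓞 F) F t * Algebra.norm F y) (by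
      rw [map_mul, hNm]
      have h1 := FractionalIdeal.mul_mem_mul (hpQ t ht) (FractionalIdeal.mul_mem_mul hy (hS y hy))
      have e : Q * Q * (B * Q⁻¹ * (B * Q⁻¹)) = B * B := by field_simp
      rwa [e] at h1) 1
    refine ⟨n, ?_⟩
    rw [← hn]
    congr 1
    have e1 : ((1 : 𝓞 F) : F) = 1 := map_one (algebraMap (𝓞 F) F)
    rw [e1]
    ring
  refine pgs_contra hdeg hinf σ hσ htr hNm c hc0 p₁ p₂ hp1 hp2 hp10 hp20 h22
    ((B : Submodule (𝓞 k) k).restrictScalars (𝓞 F))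
    (((B * Q₁⁻¹ : FractionalIdeal (𝓞 k)⁰ k) : Submodule (𝓞 k) k).restrictScalars (𝓞 F))
    (((B * Q₂⁻¹ : FractionalIdeal (𝓞 k)⁰ k) : Submodule (𝓞 k) k).restrictScalars (𝓞 F))
    (((B * (Q₁ * Q₂)⁻¹ : FractionalIdeal (𝓞 k)⁰ k) : Submodule (𝓞 k) k).restrictScalars (𝓞 F))
    hLM1 hM1M hM2M ?_ ?_ hLfull ?_ ?_ ?_ ?_ y₁ y₂ hy1 hy2 hg1 hg2 ht1 ht2
    (hχ p₁ Q₁ y₁ hQ10 hpQ1 hSM1 hy1) (hχ p₂ Q₂ y₂ hQ20 hpQ2 hSM2 hy2) ε he1 he2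
  · intro x (hx : x ∈ B * (Q₁ * Q₂)⁻¹)
    refine ⟨b * x, ?_, a * x, ?_, ?_⟩
    · have h1 := FractionalIdeal.mul_mem_mul hb hx
      have e : Q₂ * (B * (Q₁ * Q₂)⁻¹) = B * Q₁⁻¹ := by field_simp
      rw [e] at h1
      exact h1
    · have h1 := FractionalIdeal.mul_mem_mul ha hx
      have e : Q₁ * (B * (Q₁ * Q₂)⁻¹) = B * Q₂⁻¹ := by field_simp
      rw [e] at h1
      exact h1
    · linear_combination -x * hab
  · intro x (hx1 : x ∈ B * Q₁⁻¹) (hx2 : x ∈ B * Q₂⁻¹)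
    have h1 := FractionalIdeal.mul_mem_mul ha hx1
    have h2 := FractionalIdeal.mul_mem_mul hb hx2
    have e1 : Q₁ * (B * Q₁⁻¹) = B := by field_simp
    have e2 : Q₂ * (B * Q₂⁻¹) = B := by field_simp
    rw [e1] at h1
    rw [e2] at h2
    have h3 : a * x + b * x ∈ B := Submodule.add_mem B.coeToSubmodule h1 h2
    rw [← add_mul, hab, one_mul] at h3
    exact h3
  · intro x (hx : x ∈ B) t
    exact hTF _ (by rw [hNm]; exact FractionalIdeal.mul_mem_mul hx (hSB x hx)) t
  · intro x
    constructor
    · intro (hx : x ∈ B * (Q₁ * Q₂)⁻¹) y (hy : y ∈ B)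
      rw [pgs_b_apply]
      refine pgs_Tk B T (Q₁ * Q₂) _ hB0 hT0 hdual _ rfl hC _ ?_
      have h1 := FractionalIdeal.mul_mem_mul hx (hSB y hy)
      have e : B * (Q₁ * Q₂)⁻¹ * B = B * B * (Q₁ * Q₂)⁻¹ := by ring
      rwa [e] at h1
    · intro h
      have h1 := pgs_dualmem σ B T (Q₁ * Q₂) _ B hB0 hT0 hB0 hσ hSB hdual c hc0 rfl hC x h
      have e : B * B * (Q₁ * Q₂)⁻¹ * B⁻¹ = B * (Q₁ * Q₂)⁻¹ := by field_simp
      rw [e] at h1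
      exact h1
  · intro x h
    have h1 := pgs_dualmem σ B T (Q₁ * Q₂) _ (B * (Q₁ * Q₂)⁻¹) hB0 hT0 hM0 hσ hSM hdual c hc0 rfl hC x h
    have e : B * B * (Q₁ * Q₂)⁻¹ * (B * (Q₁ * Q₂)⁻¹)⁻¹ = B := by field_simp
    rw [e] at h1
    exact h1
  · intro x (hx : x ∈ B * Q₁⁻¹) y (hy : y ∈ B * Q₂⁻¹)
    rw [pgs_b_apply]
    refine pgs_Tk B T (Q₁ * Q₂) _ hB0 hT0 hdual _ rfl hC _ ?_
    have h1 := FractionalIdeal.mul_mem_mul hy (hSM1 x hx)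
    have e : B * Q₂⁻¹ * (B * Q₁⁻¹) = B * B * (Q₁ * Q₂)⁻¹ := by rw [mul_inv]; ring
    rwa [e] at h1

lemma pgs_sym (p : Ideal (𝓞 F)) (hp : p.IsPrime) (hN : Odd (Ideal.absNorm p)) (ε : (𝓞 F)ˣ) :
    quadResSym F p (ε : 𝓞 F) = 1 ↔ IsSquare (Ideal.Quotient.mk p (ε : 𝓞 F)) := by
  have hp0 := pgs_ne_bot p hN
  have h2 := pgs_two_notMem p hp hN
  haveI := hp.isMaximal hp0
  letI : Field (𝓞 F ⧸ p) := Ideal.Quotient.field p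
  haveI : Finite (𝓞 F ⧸ p) := Ideal.finiteQuotientOfFreeOfNeBot p hp0
  letI : Fintype (𝓞 F ⧸ p) := Fintype.ofFinite _
  have hchar : ringChar (𝓞 F ⧸ p) ≠ 2 := by
    intro h
    apply h2
    rw [← Ideal.Quotient.eq_zero_iff_mem]
    have := ringChar.Nat.cast_ringChar (R := 𝓞 F ⧸ p)
    rw [h] at this
    rw [map_ofNat]
    exact_mod_cast this
  have hε : Ideal.Quotient.mk p (ε : 𝓞 F) ≠ 0 := (ε.isUnit.map (Ideal.Quotient.mk p)).ne_zero
  have hcard : Fintype.card (𝓞 F ⧸ p) = Ideal.absNorm p := by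
    rw [← Nat.card_eq_fintype_card, Ideal.absNorm_apply]; rfl
  have hhalf : (Ideal.absNorm p - 1) / 2 = Ideal.absNorm p / 2 := by
    obtain ⟨m, hm⟩ := hN; omega
  rw [FiniteField.isSquare_iff hchar hε, hcard, ← hhalf, ← map_pow, ← map_one (Ideal.Quotient.mk p),
    Ideal.Quotient.eq]
  unfold quadResSym
  split_ifs with h
  · simp [h]
  · simp [h]

end pgsG

/-- If `k/F` is a quadratic extension of a number field with odd class number in which
exactly the two prime ideals `𝔭₁, 𝔭₂` of odd norm ramify, then `(E_F/𝔭₁) = (E_F/𝔭₂)`: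
`𝔭₁` is primary iff `𝔭₂` is primary. -/
theorem primary_iff_primary_of_two_ramified
    (F : Type*) [Field F] [NumberField F]
    (hoddF : Odd (NumberField.classNumber F))
    (k : Type*) [Field k] [NumberField k] [Algebra F k]
    (hdeg : Module.finrank F k = 2)
    (𝔭₁ 𝔭₂ : Ideal (𝓞 F)) (hp1 : 𝔭₁.IsPrime) (hp2 : 𝔭₂.IsPrime) (hne : 𝔭₁ ≠ 𝔭₂)
    (hN1 : Odd (Ideal.absNorm 𝔭₁)) (hN2 : Odd (Ideal.absNorm 𝔭₂))
    (hram : ∀ 𝔭 : Ideal (𝓞 F), 𝔭.IsPrime → 𝔭 ≠ ⊥ →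
      (IsRamifiedIn F k 𝔭 ↔ 𝔭 = 𝔭₁ ∨ 𝔭 = 𝔭₂))
    (hinf : UnramifiedAtInfinitePlaces F k)
    : IsPrimaryIdeal F 𝔭₁ ↔ IsPrimaryIdeal F 𝔭₂ := by
  constructor
  · intro h ε
    exact (pgs_sym 𝔭₂ hp2 hN2 ε).mpr (pgs_square hoddF hdeg 𝔭₁ 𝔭₂ hp1 hp2 hne hN1 hN2 hram hinf ε
      ((pgs_sym 𝔭₁ hp1 hN1 ε).mp (h ε)))
  · intro h ε
    exact (pgs_sym 𝔭₁ hp1 hN1 ε).mpr (pgs_square hoddF hdeg 𝔭₂ 𝔭₁ hp2 hp1 hne.symm hN2 hN1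
      (fun p hp hp0 => (hram p hp hp0).trans or_comm) hinf ε
      ((pgs_sym 𝔭₂ hp2 hN2 ε).mp (h ε)))
end
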